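/- The invariant ring R₂^{SL₂} equals the F_q-subalgebra of R₂ generated by {d₂₂, c₂₁, d₂₂*, c₂₁*, u₁*, u₀, u₁} ∪ {h_s : 1 ≤ s ≤ q−2}. -/

import Mathlib

open MvPolynomial

noncomputable section

abbrev R2 (F : Type) [Field F] : Type := MvPolynomial (Fin 4) F

/-- The action of `A ∈ GL₂(F)` on `R₂ = F[x₁,x₂,y₁,y₂]` (variables `X 0, X 1, X 2, X 3`). -/
def act {F : Type} [Field F] (A : GL (Fin 2) F) : R2 F →ₐ[F] R2 F :=
  aeval ![C ((A.val.det)⁻¹ * A.val 1 1) * X 0 - C ((A.val.det)⁻¹ * A.val 1 0) * X 1,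
          C ((A.val.det)⁻¹ * A.val 0 0) * X 1 - C ((A.val.det)⁻¹ * A.val 0 1) * X 0,
          C (A.val 0 0) * X 2 + C (A.val 0 1) * X 3,
          C (A.val 1 0) * X 2 + C (A.val 1 1) * X 3]

/-- The invariant ring `R₂^G` for a subgroup `G ≤ GL₂(F)`. -/
def invariantRing {F : Type} [Field F] (G : Subgroup (GL (Fin 2) F)) : Subalgebra F (R2 F) where
  carrier := {f | ∀ A ∈ G, act A f = f}
  mul_mem' := fun hf hg A hA => by rw [map_mul, hf A hA, hg A hA]
  add_mem' := fun hf hg A hA => by rw [map_add, hf A hA, hg A hA]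
  one_mem' := fun A _ => map_one (act A)
  zero_mem' := fun A _ => map_zero (act A)
  algebraMap_mem' := fun r A _ => (act A).commutes r

/-- `SL₂(F)` as a subgroup of `GL₂(F)`. -/
def SL2 (F : Type) [Field F] : Subgroup (GL (Fin 2) F) where
  carrier := {A | A.val.det = 1}
  one_mem' := by simp
  mul_mem' := by
    intro a b ha hb
    simp only [Set.mem_setOf_eq, Units.val_mul, Matrix.det_mul] at *
    rw [ha, hb, mul_one]
  inv_mem' := by
    intro a ha
    have h : ((a⁻¹).val * a.val).det = 1 := by
      rw [← Units.val_mul, inv_mul_cancel, Units.val_one, Matrix.det_one]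
    simp only [Matrix.det_mul] at h
    rw [Set.mem_setOf_eq] at ha ⊢
    rw [ha, mul_one] at h
    exact h

/-- `P₂(F)`: upper triangular matrices in `SL₂(F)` with 1's on the diagonal. -/
def P2 (F : Type) [Field F] : Subgroup (GL (Fin 2) F) where
  carrier := {A | A.val 0 0 = 1 ∧ A.val 1 1 = 1 ∧ A.val 1 0 = 0}
  one_mem' := by simp
  mul_mem' := by
    intro a b ha hb
    obtain ⟨ha1, ha2, ha3⟩ := ha
    obtain ⟨hb1, hb2, hb3⟩ := hb
    refine ⟨?_, ?_, ?_⟩ <;>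
      simp [Units.val_mul, Matrix.mul_apply, Fin.sum_univ_two, ha1, ha2, ha3, hb1, hb2, hb3]
  inv_mem' := by
    intro a ha
    obtain ⟨ha1, ha2, ha3⟩ := ha
    have hdet : a.val.det = 1 := by
      rw [Matrix.det_fin_two, ha1, ha2, ha3]; ring
    have hinv : (a⁻¹).val = a.val⁻¹ := by
      simp [Matrix.coe_units_inv]
    refine ⟨?_, ?_, ?_⟩ <;>
      simp [hinv, Matrix.inv_def, hdet, Matrix.adjugate_fin_two, ha1, ha2, ha3]

def d22 (F : Type) [Field F] (q : ℕ) : R2 F := X 1 * X 0 ^ q - X 0 * X 1 ^ q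
def d22s (F : Type) [Field F] (q : ℕ) : R2 F := X 2 * X 3 ^ q - X 3 * X 2 ^ q
def u0 (F : Type) [Field F] : R2 F := X 0 * X 2 + X 1 * X 3
def u1 (F : Type) [Field F] (q : ℕ) : R2 F := X 0 ^ q * X 2 + X 1 ^ q * X 3
def u1s (F : Type) [Field F] (q : ℕ) : R2 F := X 0 * X 2 ^ q + X 1 * X 3 ^ q
def phi1 (F : Type) [Field F] : R2 F := X 0
def phi2 (F : Type) [Field F] (q : ℕ) : R2 F := X 1 ^ q - X 1 * X 0 ^ (q - 1)
def phi1s (F : Type) [Field F] : R2 F := X 3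
def phi2s (F : Type) [Field F] (q : ℕ) : R2 F := X 2 ^ q - X 2 * X 3 ^ (q - 1)

section Segre

variable {M : Type*} [CommMonoid M]

/-- The normal form of a monomial in `D, u, v, d, h 0, …, h r` having `k` factors among
`D, u, v, d` and `l` factors among the `h s`, where `α` counts the factors `v, d`, and `β` counts
the factors `u, d` together with the indices of the `h s`. -/
def segre (D u v d : M) (h : ℕ → M) (r : ℕ) : ℕ → ℕ → ℕ → ℕ → M
  | 0, 0, _, _ => 1
  | 0, l + 1, α, β => h (min β r) * segre D u v d h r 0 l α (β - min β r)
  | k + 1, l, 0, 0 => D * segre D u v d h r k l 0 0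
  | k + 1, l, 0, β + 1 => u * segre D u v d h r k l 0 β
  | k + 1, l, α + 1, 0 => v * segre D u v d h r k l α 0
  | k + 1, l, α + 1, β + 1 => d * segre D u v d h r k l α β

/-- The relations between `D, u, v, d, h 0, …, h r` identifying monomials of the same weight. -/
structure SegreRel (D u v d : M) (h : ℕ → M) (r : ℕ) : Prop where
  uv : u * v = d * D
  uh : ∀ s < r, u * h s = D * h (s + 1)
  vh : ∀ s < r, v * h (s + 1) = d * h s
  hh : ∀ s < r, ∀ t < r, h s * h (t + 1) = h (s + 1) * h t
  pow : ∀ s ≤ r, u ^ (s + 1) * D ^ (r - s) = v ^ (r + 1 - s) * d ^ s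

namespace SegreRel

variable {D u v d : M} {h : ℕ → M} {r : ℕ} (H : SegreRel D u v d h r)

include H

lemma hh_shift (n : ℕ) : ∀ s t, s + n ≤ r → t + n ≤ r → h s * h (t + n) = h (s + n) * h t := by
  induction n with
  | zero => simp
  | succ n ih =>
    intro s t hs ht
    rw [← add_assoc, H.hh s (by omega) (t + n) (by omega), ih (s + 1) t (by omega) (by omega)]
    congr 2
    omega

lemma hh_eq {s t s' t' : ℕ} (hs : s ≤ r) (ht : t ≤ r) (hs' : s' ≤ r) (ht' : t' ≤ r)
    (e : s + t = s' + t') : h s * h t = h s' * h t' := by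
  rcases le_total s s' with hle | hle
  · obtain ⟨n, rfl⟩ := Nat.exists_eq_add_of_le hle
    obtain rfl : t = t' + n := by omega
    exact H.hh_shift n s t' hs' ht
  · obtain ⟨n, rfl⟩ := Nat.exists_eq_add_of_le hle
    obtain rfl : t' = t + n := by omega
    exact (H.hh_shift n s' t hs ht').symm

lemma h_mul_segre_zero (l : ℕ) : ∀ s β, s ≤ r → β ≤ r * l →
    h s * segre D u v d h r 0 l 0 β = segre D u v d h r 0 (l + 1) 0 (β + s) := by
  induction l with
  | zero =>
    intro s β hs hβ
    obtain rfl : β = 0 := by simpa using hβ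
    simp [segre, hs]
  | succ l ih =>
    intro s β hs hβ
    rw [Nat.mul_succ] at hβ
    rw [segre, segre, ← mul_assoc,
      H.hh_eq (s' := min (β + s) r) (t' := s + min β r - min (β + s) r) hs (min_le_right _ _)
        (min_le_right _ _) (by omega) (by omega), mul_assoc, ih _ _ (by omega) (by omega)]
    congr 2
    omega

lemma mul_D (k : ℕ) : ∀ l α β, α ≤ k → β ≤ k + r * l →
    D * segre D u v d h r k l α β = segre D u v d h r (k + 1) l α β := by
  induction k with
  | zero =>
    intro l α β hα hβ
    obtain rfl : α = 0 := by omega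
    rcases β with _ | β
    · rw [segre]
    · rcases l with _ | l
      · simp at hβ
      rw [segre, segre, ← mul_assoc]
      have hr : 0 < r := by
        rcases Nat.eq_zero_or_pos r with rfl | h0
        · simp at hβ
        · exact h0
      obtain ⟨m, hm⟩ : ∃ m, min (β + 1) r = m + 1 := ⟨min (β + 1) r - 1, by omega⟩
      rw [Nat.mul_succ] at hβ
      rw [hm, ← H.uh m (by omega), mul_assoc, H.h_mul_segre_zero l _ _ (by omega) (by omega)]
      congr 2
      omega
  | succ k ih =>
    intro l α β hα hβ
    rcases α with _ | α <;> rcases β with _ | β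
    · simp only [segre]
    · rw [segre, segre, mul_left_comm, ih _ _ _ (by omega) (by omega)]
    · rw [segre, segre, mul_left_comm, ih _ _ _ (by omega) (by omega)]
    · rw [segre, segre, mul_left_comm, ih _ _ _ (by omega) (by omega)]

lemma mul_u (k : ℕ) : ∀ l α β, α ≤ k → β ≤ k + r * l →
    u * segre D u v d h r k l α β = segre D u v d h r (k + 1) l α (β + 1) := by
  induction k with
  | zero =>
    intro l α β hα hβ
    obtain rfl : α = 0 := by omega
    rw [segre]
  | succ k ih =>
    intro l α β hα hβ
    rcases α with _ | α <;> rcases β with _ | β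
    · simp only [segre]
    · simp only [segre]
    · rw [segre, segre, ← mul_assoc, H.uv, mul_assoc, H.mul_D _ _ _ _ (by omega) (by omega)]
    · rw [segre, segre, mul_left_comm, ih _ _ _ (by omega) (by omega)]

lemma mul_v (k : ℕ) : ∀ l α β, α ≤ k → β ≤ k + r * l →
    v * segre D u v d h r k l α β = segre D u v d h r (k + 1) l (α + 1) β := by
  induction k with
  | zero =>
    intro l α β hα hβ
    obtain rfl : α = 0 := by omega
    rcases β with _ | β
    · rw [segre]
    · rcases l with _ | l
      · simp at hβ
      rw [segre, segre, ← mul_assoc]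
      have hr : 0 < r := by
        rcases Nat.eq_zero_or_pos r with rfl | h0
        · simp at hβ
        · exact h0
      obtain ⟨m, hm⟩ : ∃ m, min (β + 1) r = m + 1 := ⟨min (β + 1) r - 1, by omega⟩
      rw [Nat.mul_succ] at hβ
      rw [hm, H.vh m (by omega), mul_assoc, H.h_mul_segre_zero l _ _ (by omega) (by omega)]
      congr 2
      omega
  | succ k ih =>
    intro l α β hα hβ
    rcases α with _ | α <;> rcases β with _ | β
    · simp only [segre]
    · rw [segre, segre, ← mul_assoc, mul_comm v, H.uv, mul_assoc,
        H.mul_D _ _ _ _ (by omega) (by omega)]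
    · simp only [segre]
    · rw [segre, segre, mul_left_comm, ih _ _ _ (by omega) (by omega)]

omit H in
lemma mul_d (k l α β : ℕ) :
    d * segre D u v d h r k l α β = segre D u v d h r (k + 1) l (α + 1) (β + 1) := by
  rw [segre]

lemma mul_h (k : ℕ) : ∀ l α β s, s ≤ r → α ≤ k → β ≤ k + r * l →
    h s * segre D u v d h r k l α β = segre D u v d h r k (l + 1) α (β + s) := by
  induction k with
  | zero =>
    intro l α β s hs hα hβ
    obtain rfl : α = 0 := by omega
    exact H.h_mul_segre_zero l s β hs (by omega)
  | succ k ih =>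
    intro l α β s hs hα hβ
    rcases α with _ | α <;> rcases β with _ | β
    · rcases s with _ | s
      · rw [segre, mul_left_comm, ih _ _ _ _ hs (by omega) (by omega), segre]
      · rw [segre, ← mul_assoc, mul_comm _ D, ← H.uh s (by omega), mul_assoc,
          ih _ _ _ _ (by omega) (by omega) (by omega), zero_add, zero_add, segre]
    · rw [segre, mul_left_comm, ih _ _ _ _ hs (by omega) (by omega), add_right_comm, segre]
    · rcases s with _ | s
      · rw [segre, mul_left_comm, ih _ _ _ _ hs (by omega) (by omega), segre]
      · rw [segre, ← mul_assoc, mul_comm _ v, H.vh s (by omega), mul_assoc,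
          ih _ _ _ _ (by omega) (by omega) (by omega), zero_add, zero_add, segre]
    · rw [segre, mul_left_comm, ih _ _ _ _ hs (by omega) (by omega), add_right_comm, segre]

lemma pow_D (n : ℕ) {k l α β : ℕ} (hα : α ≤ k) (hβ : β ≤ k + r * l) :
    D ^ n * segre D u v d h r k l α β = segre D u v d h r (k + n) l α β := by
  induction n with
  | zero => simp
  | succ n ih => rw [pow_succ', mul_assoc, ih, H.mul_D _ _ _ _ (by omega) (by omega), add_assoc]

lemma pow_u (n : ℕ) {k l α β : ℕ} (hα : α ≤ k) (hβ : β ≤ k + r * l) :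
    u ^ n * segre D u v d h r k l α β = segre D u v d h r (k + n) l α (β + n) := by
  induction n with
  | zero => simp
  | succ n ih =>
    rw [pow_succ', mul_assoc, ih, H.mul_u _ _ _ _ (by omega) (by omega), add_assoc, add_assoc]

lemma pow_v (n : ℕ) {k l α β : ℕ} (hα : α ≤ k) (hβ : β ≤ k + r * l) :
    v ^ n * segre D u v d h r k l α β = segre D u v d h r (k + n) l (α + n) β := by
  induction n with
  | zero => simp
  | succ n ih =>
    rw [pow_succ', mul_assoc, ih, H.mul_v _ _ _ _ (by omega) (by omega), add_assoc, add_assoc]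

omit H in
lemma pow_d (n k l α β : ℕ) :
    d ^ n * segre D u v d h r k l α β = segre D u v d h r (k + n) l (α + n) (β + n) := by
  induction n with
  | zero => simp
  | succ n ih => rw [pow_succ', mul_assoc, ih, mul_d, add_assoc, add_assoc, add_assoc]

lemma segre_carry {k l α β : ℕ} (hα : α + (r + 1) ≤ k) (hβ : β + 1 ≤ k + r * l) :
    segre D u v d h r k l (α + (r + 1)) β = segre D u v d h r k l α (β + 1) := by
  obtain ⟨k, rfl⟩ := Nat.exists_eq_add_of_le' (show r + 1 ≤ k by omega)
  obtain ⟨b, β', hb, rfl, hb'⟩ : ∃ b β', b ≤ r ∧ β = β' + b ∧ β' ≤ k + r * l :=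
    ⟨min β r, β - min β r, by omega, by omega, by omega⟩
  have e := congrArg (· * segre D u v d h r k l α β') (H.pow b hb)
  simp only [mul_assoc] at e
  rw [H.pow_D _ (by omega) hb', H.pow_u _ (by omega) (by omega), pow_d,
    H.pow_v _ (by omega) (by omega)] at e
  rw [show k + (r - b) + (b + 1) = k + (r + 1) by omega,
    show k + b + (r + 1 - b) = k + (r + 1) by omega,
    show α + b + (r + 1 - b) = α + (r + 1) by omega] at e
  rw [← e, add_assoc]

lemma segre_carry_mul (n : ℕ) : ∀ {k l α β : ℕ}, α + (r + 1) * n ≤ k → β + n ≤ k + r * l →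
    segre D u v d h r k l (α + (r + 1) * n) β = segre D u v d h r k l α (β + n) := by
  induction n with
  | zero => simp
  | succ n ih =>
    intro k l α β hα hβ
    rw [Nat.mul_succ] at hα ⊢
    rw [← add_assoc, H.segre_carry (by omega) (by omega), ih (by omega) (by omega)]
    congr 1
    omega

/-- Normal forms with the same weight `α + (r + 1) β` agree. -/
lemma segre_eq {k l α β α' β' : ℕ} (hα : α ≤ k) (hβ : β ≤ k + r * l) (hα' : α' ≤ k)
    (hβ' : β' ≤ k + r * l) (e : α + (r + 1) * β = α' + (r + 1) * β') :
    segre D u v d h r k l α β = segre D u v d h r k l α' β' := by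
  rcases le_total β β' with hle | hle
  · obtain ⟨n, rfl⟩ := Nat.exists_eq_add_of_le hle
    obtain rfl : α = α' + (r + 1) * n := by rw [mul_add] at e; omega
    exact H.segre_carry_mul n hα hβ'
  · obtain ⟨n, rfl⟩ := Nat.exists_eq_add_of_le hle
    obtain rfl : α' = α + (r + 1) * n := by rw [mul_add] at e; omega
    exact (H.segre_carry_mul n hα' hβ).symm

end SegreRel

end Segre

section Trailing

variable {F : Type*} [Field F]

/-- `f` has lowest term `x ^ i * y ^ j * z ^ k` as a polynomial in `z` over `F[x, y]`. -/
def HasTrailing (f : Polynomial (MvPolynomial (Fin 2) F)) (k i j : ℕ) : Prop :=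
  ∃ g : Polynomial (MvPolynomial (Fin 2) F),
    f = Polynomial.X ^ k * g ∧ g.coeff 0 = X 0 ^ i * X 1 ^ j

namespace HasTrailing

lemma one : HasTrailing (1 : Polynomial (MvPolynomial (Fin 2) F)) 0 0 0 := ⟨1, by simp, by simp⟩

lemma mul {f g : Polynomial (MvPolynomial (Fin 2) F)} {k i j k' i' j' : ℕ}
    (hf : HasTrailing f k i j) (hg : HasTrailing g k' i' j') :
    HasTrailing (f * g) (k + k') (i + i') (j + j') := by
  obtain ⟨a, rfl, ha⟩ := hf
  obtain ⟨b, rfl, hb⟩ := hg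
  exact ⟨a * b, by ring, by rw [Polynomial.mul_coeff_zero, ha, hb]; ring⟩

lemma mul' {f g : Polynomial (MvPolynomial (Fin 2) F)} {k i j k' i' j' K I J : ℕ}
    (hf : HasTrailing f k i j) (hg : HasTrailing g k' i' j') (hk : k + k' = K) (hi : i + i' = I)
    (hj : j + j' = J) : HasTrailing (f * g) K I J := by
  subst hk hi hj
  exact hf.mul hg

lemma pow {f : Polynomial (MvPolynomial (Fin 2) F)} {k i j : ℕ}
    (hf : HasTrailing f k i j) (n : ℕ) : HasTrailing (f ^ n) (n * k) (n * i) (n * j) := by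
  induction n with
  | zero => simpa using one
  | succ n ih =>
    rw [pow_succ]
    exact ih.mul' hf (by ring) (by ring) (by ring)

lemma ne_zero {f : Polynomial (MvPolynomial (Fin 2) F)} {k i j : ℕ} (hf : HasTrailing f k i j) :
    f ≠ 0 := by
  obtain ⟨g, rfl, hg⟩ := hf
  refine mul_ne_zero (pow_ne_zero _ Polynomial.X_ne_zero) ?_
  rintro rfl
  rw [Polynomial.coeff_zero] at hg
  exact mul_ne_zero (pow_ne_zero _ (X_ne_zero _)) (pow_ne_zero _ (X_ne_zero _)) hg.symm

lemma coeff_of_lt {f : Polynomial (MvPolynomial (Fin 2) F)} {k i j n : ℕ}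
    (hf : HasTrailing f k i j) (hn : n < k) : f.coeff n = 0 := by
  obtain ⟨g, rfl, -⟩ := hf
  rw [Polynomial.coeff_X_pow_mul', if_neg (by omega)]

lemma coeff_self {f : Polynomial (MvPolynomial (Fin 2) F)} {k i j : ℕ}
    (hf : HasTrailing f k i j) :
    f.coeff k = monomial (Finsupp.single 0 i + Finsupp.single 1 j) 1 := by
  obtain ⟨g, rfl, hg⟩ := hf
  rw [Polynomial.coeff_X_pow_mul', if_pos le_rfl, Nat.sub_self, hg, X_pow_eq_monomial,
    X_pow_eq_monomial, monomial_mul, one_mul]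

/-- Polynomials with distinct monic lowest terms are linearly independent. -/
lemma linearIndependent {ι : Type*} {f : ι → Polynomial (MvPolynomial (Fin 2) F)}
    {w : ι → ℕ × ℕ × ℕ} (hf : ∀ t, HasTrailing (f t) (w t).1 (w t).2.1 (w t).2.2)
    (hw : Function.Injective w) : LinearIndependent F f := by
  classical
  rw [linearIndependent_iff]
  intro c hc
  by_contra hne
  obtain ⟨t, ht, hmin⟩ := c.support.exists_min_image (fun t => (w t).1)
    (Finsupp.support_nonempty_iff.2 hne)
  apply Finsupp.mem_support_iff.1 ht
  have h1 := congrArg (fun p => MvPolynomial.coeff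
    (Finsupp.single 0 (w t).2.1 + Finsupp.single 1 (w t).2.2) (p.coeff (w t).1)) hc
  simp only [Finsupp.linearCombination_apply, Finsupp.sum, Polynomial.finsetSum_coeff,
    Polynomial.coeff_smul, MvPolynomial.coeff_sum, MvPolynomial.coeff_smul, Polynomial.coeff_zero,
    MvPolynomial.coeff_zero] at h1
  rw [Finset.sum_eq_single t] at h1
  · rw [(hf t).coeff_self, MvPolynomial.coeff_monomial, if_pos rfl] at h1
    simpa using h1
  · intro b hb hbt
    rcases (hmin b hb).lt_or_eq with hlt | heq
    · rw [(hf b).coeff_of_lt hlt]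
      simp
    · rw [heq, (hf b).coeff_self, MvPolynomial.coeff_monomial, if_neg, smul_zero]
      intro e
      apply hbt
      apply hw
      have e0 := DFunLike.congr_fun e 0
      have e1 := DFunLike.congr_fun e 1
      simp at e0 e1
      exact Prod.ext heq.symm (Prod.ext e0 e1)
  · intro h
    exact absurd ht h

end HasTrailing

lemma HasTrailing.segre {Q : Type*} [CommRing Q] [Algebra F Q] {D u v d : Q} {h : ℕ → Q} {r : ℕ}
    (θ : Q →ₐ[F] Polynomial (MvPolynomial (Fin 2) F))
    (hD : HasTrailing (θ D) 1 0 (r + 2)) (hu : HasTrailing (θ u) 1 (r + 1) 1)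
    (hv : HasTrailing (θ v) 1 1 (r + 1)) (hd : HasTrailing (θ d) 1 (r + 2) 0)
    (hh : ∀ s ≤ r, HasTrailing (θ (h s)) 0 ((r + 1) * s) ((r + 1) * (r - s)))
    (k l α β : ℕ) (hα : α ≤ k) (hβ : β ≤ k + r * l) :
    HasTrailing (θ (segre D u v d h r k l α β)) k (α + (r + 1) * β)
      ((k - α) + (r + 1) * (k + r * l - β)) := by
  induction k generalizing α β with
  | zero =>
    obtain rfl : α = 0 := by omega
    induction l generalizing β with
    | zero =>
      obtain rfl : β = 0 := by simpa using hβ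
      simpa [_root_.segre] using HasTrailing.one
    | succ l ih =>
      rw [Nat.mul_succ] at hβ
      rw [_root_.segre, map_mul]
      obtain ⟨m, b, e1, e2, e3, e4⟩ : ∃ m b, min β r = m ∧ β = b + m ∧ m ≤ r ∧ b ≤ 0 + r * l :=
        ⟨min β r, β - min β r, rfl, by omega, by omega, by omega⟩
      obtain ⟨m', rfl⟩ := Nat.exists_eq_add_of_le e3
      obtain ⟨c, hc⟩ := Nat.exists_eq_add_of_le e4
      rw [e1, e2, Nat.add_sub_cancel]
      refine (hh _ e3).mul' (ih b e4) rfl (by ring) ?_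
      rw [Nat.mul_succ, show 0 + ((m + m') * l + (m + m')) - (b + m) = c + m' by omega, hc]
      simp only [Nat.add_sub_cancel_left]
      ring
  | succ k ih =>
    rcases α with _ | α <;> rcases β with _ | β
    · rw [_root_.segre, map_mul]
      refine hD.mul' (ih 0 0 (by omega) (by omega)) (by ring) (by ring) ?_
      simp only [Nat.sub_zero]
      ring
    · rw [_root_.segre, map_mul]
      refine hu.mul' (ih 0 β (by omega) (by omega)) (by ring) (by ring) ?_
      rw [show k + 1 + r * l - (β + 1) = k + r * l - β by omega]
      simp only [Nat.sub_zero]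
      ring
    · rw [_root_.segre, map_mul]
      refine hv.mul' (ih α 0 (by omega) (by omega)) (by ring) (by ring) ?_
      rw [show k + 1 - (α + 1) = k - α by omega]
      simp only [Nat.sub_zero]
      ring
    · rw [_root_.segre, map_mul]
      refine hd.mul' (ih α β (by omega) (by omega)) (by ring) (by ring) ?_
      rw [show k + 1 + r * l - (β + 1) = k + r * l - β by omega,
        show k + 1 - (α + 1) = k - α by omega]
      ring

lemma SegreRel.injective {Q : Type*} [CommRing Q] [Algebra F Q] {D u v d : Q} {h : ℕ → Q} {r : ℕ}
    (H : SegreRel D u v d h r) (hr : 0 < r)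
    (hgen : Algebra.adjoin F ({D, u, v, d} ∪ h '' {s | s ≤ r}) = ⊤)
    (θ : Q →ₐ[F] Polynomial (MvPolynomial (Fin 2) F))
    (hD : HasTrailing (θ D) 1 0 (r + 2)) (hu : HasTrailing (θ u) 1 (r + 1) 1)
    (hv : HasTrailing (θ v) 1 1 (r + 1)) (hd : HasTrailing (θ d) 1 (r + 2) 0)
    (hh : ∀ s ≤ r, HasTrailing (θ (h s)) 0 ((r + 1) * s) ((r + 1) * (r - s))) :
    Function.Injective θ := by
  rw [injective_iff_map_eq_zero]
  intro x hx
  let Box : Type := {t : ℕ × ℕ × ℕ × ℕ // t.2.2.1 ≤ t.1 ∧ t.2.2.2 ≤ t.1 + r * t.2.1}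
  let Φ : Box → Q := fun t => _root_.segre D u v d h r t.1.1 t.1.2.1 t.1.2.2.1 t.1.2.2.2
  let wt : Box → ℕ × ℕ × ℕ := fun t => (t.1.1, t.1.2.2.1 + (r + 1) * t.1.2.2.2,
    (t.1.1 - t.1.2.2.1) + (r + 1) * (t.1.1 + r * t.1.2.1 - t.1.2.2.2))
  have hwt : ∀ s t, wt s = wt t → Φ s = Φ t := by
    rintro ⟨⟨k, l, α, β⟩, hα, hβ⟩ ⟨⟨k', l', α', β'⟩, hα', hβ'⟩ e
    simp only [wt, Prod.mk.injEq] at e hα hβ hα' hβ'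
    obtain ⟨rfl, e1, e2⟩ := e
    have e3 : (r + 1) * (k + r * l) = (r + 1) * (k + r * l') := by
      obtain ⟨a, ha⟩ := Nat.exists_eq_add_of_le hα
      obtain ⟨a', ha'⟩ := Nat.exists_eq_add_of_le hα'
      obtain ⟨b, hb⟩ := Nat.exists_eq_add_of_le hβ
      obtain ⟨b', hb'⟩ := Nat.exists_eq_add_of_le hβ'
      rw [hb, hb', Nat.add_sub_cancel_left, Nat.add_sub_cancel_left] at e2
      rw [hb, hb', mul_add, mul_add]
      omega
    obtain rfl : l = l' := by
      have := Nat.eq_of_mul_eq_mul_left (Nat.succ_pos r) e3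
      exact Nat.eq_of_mul_eq_mul_left hr (by omega)
    exact H.segre_eq hα hβ hα' hβ' e1
  let Ψ : Set.range wt → Q := fun t => Φ t.2.choose
  have hΨ : ∀ t, Φ t = Ψ ⟨wt t, t, rfl⟩ := fun t =>
    hwt _ _ (Set.mem_range_self (f := wt) t).choose_spec.symm
  have hmon : ∀ y ∈ Submonoid.closure ({D, u, v, d} ∪ h '' {s | s ≤ r}), ∃ t, Φ t = y := by
    intro y hy
    induction hy using Submonoid.closure_induction_left with
    | one => exact ⟨⟨(0, 0, 0, 0), by simp⟩, by simp [Φ, _root_.segre]⟩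
    | mul_left g hg y _ ih =>
      obtain ⟨⟨⟨k, l, α, β⟩, hα, hβ⟩, rfl⟩ := ih
      simp only at hα hβ
      rcases hg with (rfl | rfl | rfl | rfl) | ⟨s, hs, rfl⟩
      · exact ⟨⟨(k + 1, l, α, β), by simp only; omega⟩, (H.mul_D k l α β hα hβ).symm⟩
      · exact ⟨⟨(k + 1, l, α, β + 1), by simp only; omega⟩, (H.mul_u k l α β hα hβ).symm⟩
      · exact ⟨⟨(k + 1, l, α + 1, β), by simp only; omega⟩, (H.mul_v k l α β hα hβ).symm⟩
      · exact ⟨⟨(k + 1, l, α + 1, β + 1), by simp only; omega⟩, (SegreRel.mul_d k l α β).symm⟩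
      · simp only [Set.mem_ofPred_eq] at hs
        exact ⟨⟨(k, l + 1, α, β + s), by simp only [mul_add]; omega⟩,
          (H.mul_h k l α β s hs hα hβ).symm⟩
  have hspan : x ∈ Submodule.span F (Set.range Ψ) := by
    have hx' : x ∈ Subalgebra.toSubmodule
        (Algebra.adjoin F ({D, u, v, d} ∪ h '' {s | s ≤ r})) := by
      rw [hgen]
      trivial
    rw [Algebra.adjoin_eq_span] at hx'
    refine Submodule.span_mono ?_ hx'
    intro y hy
    obtain ⟨t, rfl⟩ := hmon y hy
    exact ⟨_, (hΨ t).symm⟩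
  obtain ⟨c, rfl⟩ := Finsupp.mem_span_range_iff_exists_finsupp.1 hspan
  have hli : LinearIndependent F (θ ∘ Ψ) := by
    refine HasTrailing.linearIndependent (w := fun t => t.1) ?_ Subtype.val_injective
    rintro ⟨_, t, rfl⟩
    rw [Function.comp_apply, ← hΨ]
    exact HasTrailing.segre θ hD hu hv hd hh _ _ _ _ t.2.1 t.2.2
  have hc : c = 0 := by
    apply linearIndependent_iff.1 hli
    rw [Finsupp.linearCombination_apply, ← hx, map_finsuppSum]
    simp
  simp [hc]

end Trailing

section Core

variable {F R : Type*} [Field F] [CommRing R] [IsDomain R] [Algebra F R]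

/-- The relations satisfied, after suitable changes of sign, by the invariants of a vector and a
covector. -/
structure InvRel (u0 D u v d : R) (h : ℕ → R) (r : ℕ) : Prop where
  ne : u0 ≠ 0
  uv : u * v = d * D - u0 ^ (r + 2)
  h_eq : ∀ s ≤ r, u0 ^ (r + 1) * h s = u ^ (s + 1) * D ^ (r - s) - v ^ (r + 1 - s) * d ^ s

/-- The subalgebra generated by `u0, D, u, v, d, h 0, …, h r`. -/
def genAlg (F : Type*) {R : Type*} [Field F] [CommRing R] [Algebra F R] (u0 D u v d : R)
    (h : ℕ → R) (r : ℕ) : Subalgebra F R :=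
  Algebra.adjoin F ({u0, D, u, v, d} ∪ h '' {s | s ≤ r})

section Mem

variable (F) (u0 D u v d : R) (h : ℕ → R) (r : ℕ)

omit [IsDomain R]

lemma u0_mem_genAlg : u0 ∈ genAlg F u0 D u v d h r := Algebra.subset_adjoin (by simp)

lemma D_mem_genAlg : D ∈ genAlg F u0 D u v d h r := Algebra.subset_adjoin (by simp)

lemma u_mem_genAlg : u ∈ genAlg F u0 D u v d h r := Algebra.subset_adjoin (by simp)

lemma v_mem_genAlg : v ∈ genAlg F u0 D u v d h r := Algebra.subset_adjoin (by simp)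

lemma d_mem_genAlg : d ∈ genAlg F u0 D u v d h r := Algebra.subset_adjoin (by simp)

lemma h_mem_genAlg {s : ℕ} (hs : s ≤ r) : h s ∈ genAlg F u0 D u v d h r :=
  Algebra.subset_adjoin (Or.inr ⟨s, hs, rfl⟩)

end Mem

namespace InvRel

variable {u0 D u v d : R} {h : ℕ → R} {r : ℕ} (H : InvRel u0 D u v d h r)

include H

lemma u_mul_h {s : ℕ} (hs : s < r) :
    u * h s = D * h (s + 1) + u0 * (v ^ (r - s) * d ^ s) := by
  apply mul_left_cancel₀ (pow_ne_zero (r + 1) H.ne)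
  have e1 := H.h_eq s hs.le
  have e2 := H.h_eq (s + 1) hs
  obtain ⟨m, rfl⟩ := Nat.exists_eq_add_of_lt hs
  rw [show s + m + 1 - s = m + 1 by omega, show s + m + 1 + 1 - s = m + 2 by omega] at e1
  rw [show s + m + 1 - (s + 1) = m by omega,
    show s + m + 1 + 1 - (s + 1) = m + 1 by omega] at e2
  rw [show s + m + 1 - s = m + 1 by omega]
  linear_combination u * e1 - D * e2 - v ^ (m + 1) * d ^ s * H.uv

lemma v_mul_h {s : ℕ} (hs : s < r) :
    v * h (s + 1) = d * h s - u0 * (u ^ (s + 1) * D ^ (r - s - 1)) := by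
  apply mul_left_cancel₀ (pow_ne_zero (r + 1) H.ne)
  have e1 := H.h_eq s hs.le
  have e2 := H.h_eq (s + 1) hs
  obtain ⟨m, rfl⟩ := Nat.exists_eq_add_of_lt hs
  rw [show s + m + 1 - s = m + 1 by omega, show s + m + 1 + 1 - s = m + 2 by omega] at e1
  rw [show s + m + 1 - (s + 1) = m by omega,
    show s + m + 1 + 1 - (s + 1) = m + 1 by omega] at e2
  rw [show s + m + 1 - s - 1 = m by omega]
  linear_combination v * e2 - d * e1 + u ^ (s + 1) * D ^ m * H.uv

lemma h_mul_h (s n m : ℕ) (hr : r = s + n + m + 1) :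
    h s * h (s + n + 1) = h (s + 1) * h (s + n) - u0 * (u0 * (u ^ (s + 1) * v ^ (m + 1) * D ^ m *
      d ^ s * ∑ i ∈ Finset.range n, (u * v) ^ i * (d * D) ^ (n - 1 - i))) := by
  apply mul_left_cancel₀ (pow_ne_zero (2 * (r + 1)) H.ne)
  have e1 := H.h_eq s (by omega)
  have e2 := H.h_eq (s + n + 1) (by omega)
  have e3 := H.h_eq (s + 1) (by omega)
  have e4 := H.h_eq (s + n) (by omega)
  have e5 := Commute.geom_sum₂_mul (Commute.all (u * v) (d * D)) n
  have e6 := H.uv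
  subst hr
  rw [show s + n + m + 1 - s = n + m + 1 by omega,
    show s + n + m + 1 + 1 - s = n + m + 2 by omega] at e1
  rw [show s + n + m + 1 - (s + n + 1) = m by omega,
    show s + n + m + 1 + 1 - (s + n + 1) = m + 1 by omega] at e2
  rw [show s + n + m + 1 - (s + 1) = n + m by omega,
    show s + n + m + 1 + 1 - (s + 1) = n + m + 1 by omega] at e3
  rw [show s + n + m + 1 - (s + n) = m + 1 by omega,
    show s + n + m + 1 + 1 - (s + n) = m + 2 by omega] at e4
  generalize ∑ i ∈ Finset.range n, (u * v) ^ i * (d * D) ^ (n - 1 - i) = G at e5 ⊢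
  have e7 : u0 ^ (2 * (s + n + m + 1 + 1)) * (h s * h (s + n + 1) - h (s + 1) * h (s + n)) =
      - (u ^ (s + 1) * v ^ (m + 1) * D ^ m * d ^ s) * (((u * v) ^ n - (d * D) ^ n) *
        (u * v - d * D)) := by
    calc _ = (u0 ^ (s + n + m + 1 + 1) * h s) * (u0 ^ (s + n + m + 1 + 1) * h (s + n + 1)) -
        (u0 ^ (s + n + m + 1 + 1) * h (s + 1)) * (u0 ^ (s + n + m + 1 + 1) * h (s + n)) := by ring
      _ = _ := by
        rw [e1, e2, e3, e4]
        ring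
  rw [← e5] at e7
  have e8 : u * v - d * D = - u0 ^ (s + n + m + 1 + 2) := by rw [e6]; ring
  rw [e8] at e7
  linear_combination e7

lemma exists_h_mul_h {s t : ℕ} (hs : s < r) (ht : t < r) :
    ∃ b ∈ genAlg F u0 D u v d h r, h s * h (t + 1) - h (s + 1) * h t = u0 * b := by
  have key : ∀ s t, s ≤ t → t < r →
      ∃ b ∈ genAlg F u0 D u v d h r, h s * h (t + 1) - h (s + 1) * h t = u0 * b := by
    intro s t hst ht
    obtain ⟨n, rfl⟩ := Nat.exists_eq_add_of_le hst
    obtain ⟨m, hm⟩ := Nat.exists_eq_add_of_lt ht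
    rw [H.h_mul_h s n m hm]
    have h0 := u0_mem_genAlg F u0 D u v d h r
    have h1 := D_mem_genAlg F u0 D u v d h r
    have h2 := u_mem_genAlg F u0 D u v d h r
    have h3 := v_mem_genAlg F u0 D u v d h r
    have h4 := d_mem_genAlg F u0 D u v d h r
    refine ⟨-(u0 * (u ^ (s + 1) * v ^ (m + 1) * D ^ m *
      d ^ s * ∑ i ∈ Finset.range n, (u * v) ^ i * (d * D) ^ (n - 1 - i))), ?_, by ring⟩
    refine neg_mem (mul_mem h0 (mul_mem (mul_mem (mul_mem (mul_mem (pow_mem h2 _) (pow_mem h3 _))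
      (pow_mem h1 _)) (pow_mem h4 _)) (sum_mem fun i _ => mul_mem (pow_mem (mul_mem h2 h3) _)
      (pow_mem (mul_mem h4 h1) _))))
  rcases le_total s t with hst | hst
  · exact key s t hst ht
  · obtain ⟨b, hb, e⟩ := key t s hst hs
    exact ⟨-b, neg_mem hb, by linear_combination -e⟩

/-- An element of the generated algebra that vanishes under a suitable map killing `u0` is
divisible by `u0` within the algebra. -/
lemma exists_eq_u0_mul (hr : 0 < r) (θ : R →ₐ[F] Polynomial (MvPolynomial (Fin 2) F))
    (h0 : θ u0 = 0)
    (hD : HasTrailing (θ D) 1 0 (r + 2)) (hu : HasTrailing (θ u) 1 (r + 1) 1)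
    (hv : HasTrailing (θ v) 1 1 (r + 1)) (hd : HasTrailing (θ d) 1 (r + 2) 0)
    (hh : ∀ s ≤ r, HasTrailing (θ (h s)) 0 ((r + 1) * s) ((r + 1) * (r - s)))
    {x : R} (hx : x ∈ genAlg F u0 D u v d h r) (hx0 : θ x = 0) :
    ∃ y ∈ genAlg F u0 D u v d h r, x = u0 * y := by
  classical
  set B := genAlg F u0 D u v d h r with hB
  let U0 : B := ⟨u0, u0_mem_genAlg F u0 D u v d h r⟩
  let D' : B := ⟨D, D_mem_genAlg F u0 D u v d h r⟩
  let u' : B := ⟨u, u_mem_genAlg F u0 D u v d h r⟩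
  let v' : B := ⟨v, v_mem_genAlg F u0 D u v d h r⟩
  let d' : B := ⟨d, d_mem_genAlg F u0 D u v d h r⟩
  let h' : ℕ → B := fun s => if hs : s ≤ r then ⟨h s, h_mem_genAlg F u0 D u v d h r hs⟩ else 0
  have hh' : ∀ s ≤ r, (h' s : R) = h s := fun s hs => by simp [h', hs]
  let I : Ideal B := Ideal.span {U0}
  let π : B →ₐ[F] B ⧸ I := Ideal.Quotient.mkₐ F I
  have hπ : ∀ x y : B, (∃ b ∈ B, (x : R) - y = u0 * b) → π x = π y := by
    rintro x y ⟨b, hb, e⟩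
    refine (Ideal.Quotient.mk_eq_mk_iff_sub_mem x y).2 (Ideal.mem_span_singleton.2 ⟨⟨b, hb⟩, ?_⟩)
    exact Subtype.ext e
  have hI : ∀ a ∈ I, (θ.comp B.val) a = 0 := by
    intro a ha
    obtain ⟨c, rfl⟩ := Ideal.mem_span_singleton.1 ha
    simp [U0, h0]
  let θ' : B ⧸ I →ₐ[F] Polynomial (MvPolynomial (Fin 2) F) :=
    Ideal.Quotient.liftₐ I (θ.comp B.val) hI
  have hθ' : ∀ b : B, θ' (π b) = θ b := fun b => rfl
  have S : SegreRel (π D') (π u') (π v') (π d') (fun s => π (h' s)) r := by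
    have m0 := U0.2
    have mD := D'.2
    have mu := u'.2
    have mv := v'.2
    have md := d'.2
    refine ⟨?_, ?_, ?_, ?_, ?_⟩
    · rw [← map_mul, ← map_mul]
      refine hπ _ _ ⟨-u0 ^ (r + 1), neg_mem (pow_mem m0 _), ?_⟩
      change u * v - d * D = _
      rw [H.uv]
      ring
    · intro s hs
      rw [← map_mul, ← map_mul]
      refine hπ _ _ ⟨v ^ (r - s) * d ^ s, mul_mem (pow_mem mv _) (pow_mem md _), ?_⟩
      rw [MulMemClass.coe_mul, MulMemClass.coe_mul, hh' _ hs.le, hh' _ hs]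
      change u * _ - D * _ = _
      rw [H.u_mul_h hs]
      ring
    · intro s hs
      rw [← map_mul, ← map_mul]
      refine hπ _ _ ⟨-(u ^ (s + 1) * D ^ (r - s - 1)),
        neg_mem (mul_mem (pow_mem mu _) (pow_mem mD _)), ?_⟩
      rw [MulMemClass.coe_mul, MulMemClass.coe_mul, hh' _ hs.le, hh' _ hs]
      change v * _ - d * _ = _
      rw [H.v_mul_h hs]
      ring
    · intro s hs t ht
      rw [← map_mul, ← map_mul]
      obtain ⟨b, hb, e⟩ := H.exists_h_mul_h (F := F) hs ht
      refine hπ _ _ ⟨b, hb, ?_⟩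
      rw [MulMemClass.coe_mul, MulMemClass.coe_mul, hh' _ hs.le, hh' _ hs, hh' _ ht.le, hh' _ ht, e]
    · intro s hs
      simp only [← map_pow]
      rw [← map_mul, ← map_mul]
      refine hπ _ _ ⟨u0 ^ r * h s, mul_mem (pow_mem m0 _) (h_mem_genAlg F u0 D u v d h r hs), ?_⟩
      have := H.h_eq s hs
      change u ^ (s + 1) * D ^ (r - s) - v ^ (r + 1 - s) * d ^ s = _
      rw [← this]
      ring
  have hgen : Algebra.adjoin F ({π D', π u', π v', π d'} ∪ (fun s => π (h' s)) '' {s | s ≤ r}) =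
      ⊤ := by
    rw [eq_top_iff]
    rintro y -
    obtain ⟨⟨z, hz⟩, rfl⟩ := Ideal.Quotient.mk_surjective y
    change π ⟨z, hz⟩ ∈ _
    induction hz using Algebra.adjoin_induction with
    | mem g hg =>
      rcases hg with (rfl | rfl | rfl | rfl | rfl) | ⟨s, hs, rfl⟩
      · have hU0 : π U0 = 0 := by
          rw [← map_zero π]
          exact hπ _ _ ⟨1, one_mem _, by simp [U0]⟩
        change π U0 ∈ _
        rw [hU0]
        exact zero_mem _
      · exact Algebra.subset_adjoin (by simp [D'])
      · exact Algebra.subset_adjoin (by simp [u'])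
      · exact Algebra.subset_adjoin (by simp [v'])
      · exact Algebra.subset_adjoin (by simp [d'])
      · refine Algebra.subset_adjoin (Or.inr ⟨s, hs, ?_⟩)
        exact congrArg π (Subtype.ext (hh' s hs))
    | algebraMap a => exact Subalgebra.algebraMap_mem _ a
    | add a b ha hb iha ihb => exact add_mem iha ihb
    | mul a b ha hb iha ihb => exact mul_mem iha ihb
  have inj := S.injective hr hgen θ' (by rw [hθ']; exact hD) (by rw [hθ']; exact hu)
    (by rw [hθ']; exact hv) (by rw [hθ']; exact hd)
    (fun s hs => by rw [hθ', hh' s hs]; exact hh s hs)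
  have hz : π ⟨x, hx⟩ = 0 := inj (by rw [hθ', map_zero]; exact hx0)
  obtain ⟨c, hc⟩ := Ideal.mem_span_singleton.1 (Ideal.Quotient.eq_zero_iff_mem.1 hz)
  exact ⟨c, c.2, congrArg Subtype.val hc⟩

omit [IsDomain R] in
lemma exists_uv_pow (n : ℕ) :
    ∃ z ∈ genAlg F u0 D u v d h r, (u * v) ^ n = d * z + (-u0 ^ (r + 2)) ^ n := by
  induction n with
  | zero => exact ⟨0, zero_mem _, by simp⟩
  | succ n ih =>
    obtain ⟨z, hz, e⟩ := ih
    have h0 := u0_mem_genAlg F u0 D u v d h r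
    have h1 := D_mem_genAlg F u0 D u v d h r
    have h2 := u_mem_genAlg F u0 D u v d h r
    have h3 := v_mem_genAlg F u0 D u v d h r
    refine ⟨z * (u * v) + (-u0 ^ (r + 2)) ^ n * D, add_mem (mul_mem hz (mul_mem h2 h3))
      (mul_mem (pow_mem (neg_mem (pow_mem h0 _)) _) h1), ?_⟩
    rw [pow_succ, e, pow_succ (-u0 ^ (r + 2))]
    linear_combination (-u0 ^ (r + 2)) ^ n * H.uv

omit [IsDomain R] in
lemma exists_pow_mul_eq {x : R} (hx : x ∈ genAlg F u0 D u v d h r) :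
    ∃ n, ∃ e ∈ Algebra.adjoin F {u0, u, D}, ∃ y ∈ genAlg F u0 D u v d h r,
      (u0 * u) ^ n * x = e + d * y := by
  have h0 := u0_mem_genAlg F u0 D u v d h r
  have h1 := D_mem_genAlg F u0 D u v d h r
  have h2 := u_mem_genAlg F u0 D u v d h r
  have h3 := v_mem_genAlg F u0 D u v d h r
  have h4 := d_mem_genAlg F u0 D u v d h r
  have hle : Algebra.adjoin F {u0, u, D} ≤ genAlg F u0 D u v d h r := by
    rw [Algebra.adjoin_le_iff]
    rintro _ (rfl | rfl | rfl) <;> assumption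
  have k0 : u0 ∈ Algebra.adjoin F {u0, u, D} := Algebra.subset_adjoin (by simp)
  have k1 : u ∈ Algebra.adjoin F {u0, u, D} := Algebra.subset_adjoin (by simp)
  have k2 : D ∈ Algebra.adjoin F {u0, u, D} := Algebra.subset_adjoin (by simp)
  induction hx using Algebra.adjoin_induction with
  | mem g hg =>
    rcases hg with (rfl | rfl | rfl | rfl | rfl) | ⟨s, hs, rfl⟩
    · exact ⟨0, _, k0, 0, zero_mem _, by simp⟩
    · exact ⟨0, _, k2, 0, zero_mem _, by simp⟩
    · exact ⟨0, _, k1, 0, zero_mem _, by simp⟩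
    · exact ⟨1, -u0 * u0 ^ (r + 2), mul_mem (neg_mem k0) (pow_mem k0 _), u0 * D, mul_mem h0 h1,
        by linear_combination u0 * H.uv⟩
    · exact ⟨0, 0, zero_mem _, 1, one_mem _, by simp⟩
    · replace hs : s ≤ r := hs
      obtain ⟨z, hz, e⟩ := H.exists_uv_pow (F := F) (r + 1 - s)
      refine ⟨r + 1, u ^ (r + 1) * (u ^ (s + 1) * D ^ (r - s)) -
          u ^ s * (-u0 ^ (r + 2)) ^ (r + 1 - s) * 0 ^ s,
        sub_mem (mul_mem (pow_mem k1 _) (mul_mem (pow_mem k1 _) (pow_mem k2 _)))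
          (mul_mem (mul_mem (pow_mem k1 _) (pow_mem (neg_mem (pow_mem k0 _)) _))
            (pow_mem (zero_mem _) _)), ?_⟩
      have e1 := H.h_eq s hs
      have e2 : (u0 * u) ^ (r + 1) * h s = u ^ (r + 1) * (u ^ (s + 1) * D ^ (r - s)) -
          u ^ s * (u * v) ^ (r + 1 - s) * d ^ s := by
        have e3 : u ^ (r + 1) = u ^ s * u ^ (r + 1 - s) := by
          rw [← pow_add]
          congr 1
          omega
        rw [mul_pow u v]
        linear_combination u ^ (r + 1) * e1 - v ^ (r + 1 - s) * d ^ s * e3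
      rcases s with _ | s
      · refine ⟨-z, neg_mem hz, ?_⟩
        rw [e2, e]
        ring
      · refine ⟨-(u ^ (s + 1) * (u * v) ^ (r + 1 - (s + 1)) * d ^ s), neg_mem (mul_mem (mul_mem
          (pow_mem h2 _) (pow_mem (mul_mem h2 h3) _)) (pow_mem h4 _)), ?_⟩
        rw [e2]
        ring
  | algebraMap a =>
    exact ⟨0, _, Subalgebra.algebraMap_mem _ a, 0, zero_mem _, by simp⟩
  | add a b ha hb iha ihb =>
    obtain ⟨n, e, he, y, hy, E⟩ := iha
    obtain ⟨m, e', he', y', hy', E'⟩ := ihb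
    refine ⟨n + m, (u0 * u) ^ m * e + (u0 * u) ^ n * e', add_mem
      (mul_mem (pow_mem (mul_mem k0 k1) _) he) (mul_mem (pow_mem (mul_mem k0 k1) _) he'),
      (u0 * u) ^ m * y + (u0 * u) ^ n * y', add_mem
      (mul_mem (pow_mem (mul_mem h0 h2) _) hy) (mul_mem (pow_mem (mul_mem h0 h2) _) hy'), ?_⟩
    rw [pow_add]
    linear_combination (u0 * u) ^ m * E + (u0 * u) ^ n * E'
  | mul a b ha hb iha ihb =>
    obtain ⟨n, e, he, y, hy, E⟩ := iha
    obtain ⟨m, e', he', y', hy', E'⟩ := ihb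
    refine ⟨n + m, e * e', mul_mem he he', e * y' + y * e' + y * y' * d, add_mem (add_mem
      (mul_mem (hle he) hy') (mul_mem hy (hle he'))) (mul_mem (mul_mem hy hy') h4), ?_⟩
    rw [pow_add, mul_mul_mul_comm, E, E']
    ring

/-- An element of the generated algebra that vanishes under a suitable map killing `d` is
divisible by `d` within the algebra. -/
lemma exists_eq_d_mul (hr : 0 < r) (θ ρ : R →ₐ[F] Polynomial (MvPolynomial (Fin 2) F))
    (h0 : θ u0 = 0)
    (hD : HasTrailing (θ D) 1 0 (r + 2)) (hu : HasTrailing (θ u) 1 (r + 1) 1)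
    (hv : HasTrailing (θ v) 1 1 (r + 1)) (hd : HasTrailing (θ d) 1 (r + 2) 0)
    (hh : ∀ s ≤ r, HasTrailing (θ (h s)) 0 ((r + 1) * s) ((r + 1) * (r - s)))
    (hρd : ρ d = 0) (hρ0 : HasTrailing (ρ u0) 0 1 1) (hρu : HasTrailing (ρ u) 0 (r + 1) 1)
    (hρD : HasTrailing (ρ D) 1 0 (r + 1))
    {x : R} (hx : x ∈ genAlg F u0 D u v d h r) (hx0 : ρ x = 0) :
    ∃ y ∈ genAlg F u0 D u v d h r, x = d * y := by
  have m0 := u0_mem_genAlg F u0 D u v d h r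
  have m3 := v_mem_genAlg F u0 D u v d h r
  obtain ⟨n, e, he, y, hy, E⟩ := H.exists_pow_mul_eq hx
  have he0 : ρ e = 0 := by
    have := congrArg ρ E
    simpa [hx0, hρd] using this.symm
  obtain rfl : e = 0 := by
    let Ψ : ℕ × ℕ × ℕ → R := fun t => u0 ^ t.1 * u ^ t.2.1 * D ^ t.2.2
    have hmon : ∀ y ∈ Submonoid.closure {u0, u, D}, ∃ t, Ψ t = y := by
      intro y hy
      induction hy using Submonoid.closure_induction_left with
      | one => exact ⟨(0, 0, 0), by simp [Ψ]⟩
      | mul_left g hg y _ ih =>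
        obtain ⟨⟨a, b, c⟩, rfl⟩ := ih
        rcases hg with rfl | rfl | rfl
        · exact ⟨(a + 1, b, c), by simp only [Ψ]; ring⟩
        · exact ⟨(a, b + 1, c), by simp only [Ψ]; ring⟩
        · exact ⟨(a, b, c + 1), by simp only [Ψ]; ring⟩
    have hspan : e ∈ Submodule.span F (Set.range Ψ) := by
      have he' : e ∈ Subalgebra.toSubmodule (Algebra.adjoin F {u0, u, D}) := he
      rw [Algebra.adjoin_eq_span] at he'
      exact Submodule.span_mono hmon he'
    obtain ⟨c, rfl⟩ := Finsupp.mem_span_range_iff_exists_finsupp.1 hspan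
    have hli : LinearIndependent F (ρ ∘ Ψ) := by
      refine HasTrailing.linearIndependent (w := fun t => (t.2.2, t.1 + (r + 1) * t.2.1,
        t.1 + t.2.1 + (r + 1) * t.2.2)) ?_ ?_
      · rintro ⟨a, b, c⟩
        simp only [Ψ, Function.comp_apply, map_mul, map_pow]
        exact ((hρ0.pow a).mul (hρu.pow b)).mul' (hρD.pow c) (by ring) (by ring) (by ring)
      · rintro ⟨a, b, c⟩ ⟨a', b', c'⟩ e
        simp only [Prod.mk.injEq] at e
        obtain ⟨rfl, e1, e2⟩ := e
        have e3 : r * b = r * b' := by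
          rw [add_mul, add_mul] at e1
          omega
        obtain rfl := Nat.eq_of_mul_eq_mul_left hr e3
        obtain rfl : a = a' := by omega
        rfl
    have hc : c = 0 := by
      apply linearIndependent_iff.1 hli
      rw [Finsupp.linearCombination_apply, ← he0, map_finsuppSum]
      simp
    simp [hc]
  obtain ⟨z, hz, e⟩ := H.exists_uv_pow (F := F) n
  have main : ∀ N, ∀ y ∈ genAlg F u0 D u v d h r, u0 ^ N * x = d * y →
      ∃ y ∈ genAlg F u0 D u v d h r, x = d * y := by
    intro N
    induction N with
    | zero => exact fun y hy e => ⟨y, hy, by simpa using e⟩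
    | succ N ih =>
      intro y hy e
      have hy0 : θ y = 0 := by
        have := congrArg θ e
        rw [map_mul, map_mul, map_pow, h0, zero_pow (Nat.succ_ne_zero N), zero_mul] at this
        exact (mul_eq_zero.1 this.symm).resolve_left hd.ne_zero
      obtain ⟨y', hy', rfl⟩ := H.exists_eq_u0_mul hr θ h0 hD hu hv hd hh hy hy0
      exact ih y' hy' (mul_left_cancel₀ H.ne (by linear_combination e))
  refine main (n + (r + 2) * n) ((-1) ^ n * (y * v ^ n - u0 ^ n * z * x)) (mul_mem
    (pow_mem (neg_mem (one_mem _)) _) (sub_mem (mul_mem hy (pow_mem m3 _))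
      (mul_mem (mul_mem (pow_mem m0 _) hz) hx))) ?_
  have e1 : ((-1 : R) ^ n) * (-1) ^ n = 1 := by rw [← mul_pow]; simp
  rw [neg_pow] at e
  rw [mul_pow] at e E
  linear_combination (-1) ^ n * v ^ n * E - (-1) ^ n * u0 ^ n * x * e -
    u0 ^ (n + (r + 2) * n) * x * e1

end InvRel

end Core

section Frobenius

lemma add_pow_card_field (F) [Field F] [Fintype F] {R : Type*} [CommRing R] [Algebra F R]
    {q : ℕ} (hF : Fintype.card F = q) (a b : R) : (a + b) ^ q = a ^ q + b ^ q := by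
  subst hF
  exact map_add (FiniteField.frobeniusAlgHom F R) a b

lemma sub_pow_card_field (F) [Field F] [Fintype F] {R : Type*} [CommRing R] [Algebra F R]
    {q : ℕ} (hF : Fintype.card F = q) (a b : R) : (a - b) ^ q = a ^ q - b ^ q := by
  subst hF
  exact map_sub (FiniteField.frobeniusAlgHom F R) a b

lemma C_pow_card {F : Type*} [Field F] [Fintype F] {q : ℕ} (hF : Fintype.card F = q)
    {σ : Type*} (a : F) : (C a : MvPolynomial σ F) ^ q = C a := by
  subst hF
  rw [← C_pow, FiniteField.pow_card]

end Frobenius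

section Generators

variable {F : Type} [Field F] [Fintype F] {q : ℕ} (hF : Fintype.card F = q)

include hF

lemma d22_ne_zero : d22 F q ≠ 0 := by
  intro e
  have := congrArg (aeval (![Polynomial.X, 1, 0, 0] : Fin 4 → Polynomial F)) e
  simp only [d22, map_sub, map_mul, map_pow, aeval_X, map_zero] at this
  simp at this
  subst hF
  exact FiniteField.X_pow_card_sub_X_ne_zero F Fintype.one_lt_card this

lemma d22s_ne_zero : d22s F q ≠ 0 := by
  intro e
  have := congrArg (aeval (![0, 0, 1, Polynomial.X] : Fin 4 → Polynomial F)) e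
  simp only [d22s, map_sub, map_mul, map_pow, aeval_X, map_zero] at this
  simp at this
  subst hF
  exact FiniteField.X_pow_card_sub_X_ne_zero F Fintype.one_lt_card this

omit hF [Fintype F] in
lemma u0_ne_zero : u0 F ≠ 0 := by
  intro e
  have := congrArg (aeval (![1, 0, 1, 0] : Fin 4 → F)) e
  simp [u0] at this

lemma u1_mul_u1s : u1 F q * u1s F q = d22 F q * d22s F q + u0 F ^ (q + 1) := by
  rw [pow_succ, u0, add_pow_card_field F hF, u1, u1s, d22, d22s]
  ring

lemma invRel {h : ℕ → R2 F} (hh : ∀ s ≤ q - 1, u0 F ^ q * h s =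
      u1 F q ^ (s + 1) * d22s F q ^ (q - s - 1) + u1s F q ^ (q - s) * d22 F q ^ s) :
    InvRel (u0 F) (-d22s F q) (u1 F q) (-u1s F q) (d22 F q)
      (fun s => (-1) ^ (q - 1 - s) * h s) (q - 1) := by
  have hq : 1 < q := hF ▸ Fintype.one_lt_card
  obtain ⟨r, rfl⟩ := Nat.exists_eq_add_of_le' hq.le
  refine ⟨u0_ne_zero, ?_, ?_⟩
  · have := u1_mul_u1s hF
    rw [Nat.add_sub_cancel]
    linear_combination -this
  · intro s hs
    have := hh s hs
    rw [Nat.add_sub_cancel] at hs ⊢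
    obtain ⟨m, rfl⟩ := Nat.exists_eq_add_of_le hs
    rw [show s + m + 1 - s - 1 = m by omega, show s + m + 1 - s = m + 1 by omega] at this
    rw [show s + m - s = m by omega, show s + m + 1 - s = m + 1 by omega, neg_pow (d22s F _),
      neg_pow (u1s F _)]
    linear_combination (-1) ^ m * this

lemma h_last_eq {c21 : R2 F}
    (hc21 : d22 F q * c21 = X 1 * X 0 ^ (q ^ 2) - X 0 * X 1 ^ (q ^ 2)) {h : ℕ → R2 F}
    (hh : ∀ s ≤ q - 1, u0 F ^ q * h s =
      u1 F q ^ (s + 1) * d22s F q ^ (q - s - 1) + u1s F q ^ (q - s) * d22 F q ^ s) :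
    h (q - 1) = c21 := by
  have hq : 1 < q := hF ▸ Fintype.one_lt_card
  have e := hh (q - 1) le_rfl
  rw [show q - (q - 1) - 1 = 0 by omega, show q - (q - 1) = 1 by omega,
    show q - 1 + 1 = q by omega] at e
  have e1 : d22 F q * d22 F q ^ (q - 1) = d22 F q ^ q := mul_pow_sub_one (by omega) _
  apply mul_left_cancel₀ (d22_ne_zero hF)
  apply mul_left_cancel₀ (pow_ne_zero q (u0_ne_zero (F := F)))
  rw [hc21]
  have e2 : u0 F ^ q * (X 1 * X 0 ^ (q ^ 2) - X 0 * X 1 ^ (q ^ 2)) =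
      d22 F q * u1 F q ^ q + u1s F q * d22 F q ^ q := by
    rw [u0, add_pow_card_field F hF, u1, add_pow_card_field F hF, d22, sub_pow_card_field F hF, u1s]
    ring
  rw [e2]
  linear_combination d22 F q * e + u1s F q * e1

lemma h_zero_eq {c21s : R2 F}
    (hc21s : d22s F q * c21s = X 2 * X 3 ^ (q ^ 2) - X 3 * X 2 ^ (q ^ 2)) {h : ℕ → R2 F}
    (hh : ∀ s ≤ q - 1, u0 F ^ q * h s =
      u1 F q ^ (s + 1) * d22s F q ^ (q - s - 1) + u1s F q ^ (q - s) * d22 F q ^ s) :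
    h 0 = c21s := by
  have hq : 1 < q := hF ▸ Fintype.one_lt_card
  have e := hh 0 (by omega)
  rw [Nat.sub_zero] at e
  have e1 : d22s F q * d22s F q ^ (q - 1) = d22s F q ^ q := mul_pow_sub_one (by omega) _
  apply mul_left_cancel₀ (d22s_ne_zero hF)
  apply mul_left_cancel₀ (pow_ne_zero q (u0_ne_zero (F := F)))
  rw [hc21s]
  have e2 : u0 F ^ q * (X 2 * X 3 ^ (q ^ 2) - X 3 * X 2 ^ (q ^ 2)) =
      u1 F q * d22s F q ^ q + u1s F q ^ q * d22s F q := by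
    rw [u0, add_pow_card_field F hF, u1, u1s, add_pow_card_field F hF, d22s,
      sub_pow_card_field F hF]
    ring
  rw [e2]
  linear_combination d22s F q * e + u1 F q * e1

/-- The specialization of `R2 F` onto the hypersurface `u0 = 0`. -/
def specU0 (F : Type) [Field F] : R2 F →ₐ[F] Polynomial (MvPolynomial (Fin 2) F) :=
  aeval (![Polynomial.C (X 0), Polynomial.C (X 0) * Polynomial.X,
    Polynomial.X * Polynomial.C (X 1), Polynomial.C (-X 1)] :
      Fin 4 → Polynomial (MvPolynomial (Fin 2) F))

/-- The specialization of `R2 F` onto the hyperplane `X 1 = 0`. -/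
def specX1 (F : Type) [Field F] : R2 F →ₐ[F] Polynomial (MvPolynomial (Fin 2) F) :=
  aeval (![Polynomial.C (X 0), 0, Polynomial.C (X 1), Polynomial.X] :
    Fin 4 → Polynomial (MvPolynomial (Fin 2) F))

omit hF [Fintype F] in
lemma specU0_u0 : specU0 F (u0 F) = 0 := by
  simp [specU0, u0]
  ring

lemma neg_pow_card (R : Type*) [CommRing R] [Algebra F R] (a : R) : (-a) ^ q = -a ^ q := by
  have := sub_pow_card_field F hF 0 a
  have hq : q ≠ 0 := hF ▸ Fintype.card_ne_zero
  simpa [hq] using this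

lemma one_sub_coeff_zero (M : MvPolynomial (Fin 2) F) :
    (Polynomial.C M * (1 - Polynomial.X ^ (q - 1))).coeff 0 = M := by
  have hq : 1 < q := hF ▸ Fintype.one_lt_card
  simp [Polynomial.coeff_zero_eq_eval_zero, show q - 1 ≠ 0 by omega]

lemma hasTrailing_specU0_d22 : HasTrailing (specU0 F (d22 F q)) 1 (q + 1) 0 := by
  refine ⟨Polynomial.C (X 0 ^ (q + 1)) * (1 - Polynomial.X ^ (q - 1)), ?_, ?_⟩
  · have e : (Polynomial.X : Polynomial (MvPolynomial (Fin 2) F)) * Polynomial.X ^ (q - 1) =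
      Polynomial.X ^ q := mul_pow_sub_one (hF ▸ Fintype.card_ne_zero) _
    simp [specU0, d22]
    linear_combination Polynomial.C (X 0) ^ (q + 1) * e
  · rw [one_sub_coeff_zero hF]
    simp

lemma hasTrailing_specU0_d22s : HasTrailing (specU0 F (-d22s F q)) 1 0 (q + 1) := by
  refine ⟨Polynomial.C (X 1 ^ (q + 1)) * (1 - Polynomial.X ^ (q - 1)), ?_, ?_⟩
  · have e : (Polynomial.X : Polynomial (MvPolynomial (Fin 2) F)) * Polynomial.X ^ (q - 1) =
      Polynomial.X ^ q := mul_pow_sub_one (hF ▸ Fintype.card_ne_zero) _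
    simp [specU0, d22s, neg_pow_card hF]
    linear_combination Polynomial.C (X 1) ^ (q + 1) * e
  · rw [one_sub_coeff_zero hF]
    simp

lemma hasTrailing_specU0_u1 : HasTrailing (specU0 F (u1 F q)) 1 q 1 := by
  refine ⟨Polynomial.C (X 0 ^ q * X 1) * (1 - Polynomial.X ^ (q - 1)), ?_, ?_⟩
  · have e : (Polynomial.X : Polynomial (MvPolynomial (Fin 2) F)) * Polynomial.X ^ (q - 1) =
      Polynomial.X ^ q := mul_pow_sub_one (hF ▸ Fintype.card_ne_zero) _
    simp [specU0, u1]
    linear_combination Polynomial.C (X 0) ^ q * Polynomial.C (X 1) * e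
  · rw [one_sub_coeff_zero hF]
    simp

lemma hasTrailing_specU0_u1s : HasTrailing (specU0 F (-u1s F q)) 1 1 q := by
  refine ⟨Polynomial.C (X 0 * X 1 ^ q) * (1 - Polynomial.X ^ (q - 1)), ?_, ?_⟩
  · have e : (Polynomial.X : Polynomial (MvPolynomial (Fin 2) F)) * Polynomial.X ^ (q - 1) =
      Polynomial.X ^ q := mul_pow_sub_one (hF ▸ Fintype.card_ne_zero) _
    simp [specU0, u1s, neg_pow_card hF]
    linear_combination Polynomial.C (X 0) * Polynomial.C (X 1) ^ q * e
  · rw [one_sub_coeff_zero hF]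
    simp

lemma hasTrailing_specU0_c21 {c21 : R2 F}
    (hc21 : d22 F q * c21 = X 1 * X 0 ^ (q ^ 2) - X 0 * X 1 ^ (q ^ 2)) :
    HasTrailing (specU0 F c21) 0 (q * (q - 1)) 0 := by
  have hq : 1 < q := hF ▸ Fintype.one_lt_card
  refine ⟨specU0 F c21, by simp, ?_⟩
  have e := congrArg (specU0 F) hc21
  have e1 : specU0 F (d22 F q) = Polynomial.X * (Polynomial.C (X 0 ^ (q + 1)) *
      (1 - Polynomial.X ^ (q - 1))) := by
    have e : (Polynomial.X : Polynomial (MvPolynomial (Fin 2) F)) * Polynomial.X ^ (q - 1) =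
      Polynomial.X ^ q := mul_pow_sub_one (hF ▸ Fintype.card_ne_zero) _
    simp [specU0, d22]
    linear_combination Polynomial.C (X 0) ^ (q + 1) * e
  have e2 : specU0 F (X 1 * X 0 ^ (q ^ 2) - X 0 * X 1 ^ (q ^ 2)) = Polynomial.X *
      (Polynomial.C (X 0 ^ (q ^ 2 + 1)) * (1 - Polynomial.X ^ (q ^ 2 - 1))) := by
    have e : (Polynomial.X : Polynomial (MvPolynomial (Fin 2) F)) * Polynomial.X ^ (q ^ 2 - 1) =
      Polynomial.X ^ (q ^ 2) := mul_pow_sub_one (by positivity) _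
    simp [specU0]
    linear_combination Polynomial.C (X 0) ^ (q ^ 2 + 1) * e
  rw [map_mul, e1, e2, mul_assoc] at e
  have e3 := congrArg (fun f => Polynomial.coeff f 0) (mul_left_cancel₀ Polynomial.X_ne_zero e)
  have hq2 : q ^ 2 - 1 ≠ 0 := by
    have : 1 < q ^ 2 := Nat.one_lt_pow two_ne_zero hq
    omega
  simp only [Polynomial.mul_coeff_zero] at e3
  simp [Polynomial.coeff_zero_eq_eval_zero, show q - 1 ≠ 0 by omega, hq2] at e3
  rw [pow_zero, mul_one, Polynomial.coeff_zero_eq_eval_zero]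
  apply mul_left_cancel₀ (pow_ne_zero (q + 1) (X_ne_zero (0 : Fin 2)))
  rw [e3, ← pow_add]
  congr 1
  obtain ⟨r, rfl⟩ := Nat.exists_eq_add_of_le' hq.le
  rw [Nat.add_sub_cancel]
  ring

lemma hasTrailing_specU0_h {c21 : R2 F}
    (hc21 : d22 F q * c21 = X 1 * X 0 ^ (q ^ 2) - X 0 * X 1 ^ (q ^ 2)) {h : ℕ → R2 F}
    (hh : ∀ s ≤ q - 1, u0 F ^ q * h s =
      u1 F q ^ (s + 1) * d22s F q ^ (q - s - 1) + u1s F q ^ (q - s) * d22 F q ^ s)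
    (s : ℕ) (hs : s ≤ q - 1) :
    HasTrailing (specU0 F ((-1) ^ (q - 1 - s) * h s)) 0 (q * s) (q * (q - 1 - s)) := by
  have H := invRel hF hh
  induction hs using Nat.decreasingInduction with
  | self =>
    rw [Nat.sub_self, pow_zero, one_mul, mul_zero, h_last_eq hF hc21 hh]
    exact hasTrailing_specU0_c21 hF hc21
  | of_succ s hs ih =>
    obtain ⟨g, hg, hg0⟩ := ih
    have e := congrArg (specU0 F) (H.u_mul_h hs)
    rw [map_add, map_mul _ (u0 F), specU0_u0, zero_mul, add_zero, map_mul _ (u1 F q),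
      map_mul _ (-d22s F q)] at e
    set a := specU0 F ((-1) ^ (q - 1 - s) * h s)
    have eu : specU0 F (u1 F q) = Polynomial.C (X 0) ^ q * Polynomial.C (X 1) *
        (Polynomial.X - Polynomial.X ^ q) := by
      simp [specU0, u1]
      ring
    have eD : specU0 F (-d22s F q) = Polynomial.C (X 1) ^ (q + 1) *
        (Polynomial.X - Polynomial.X ^ q) := by
      simp [specU0, d22s, neg_pow_card hF]
      ring
    have hne : Polynomial.C (X 1) * (Polynomial.X - Polynomial.X ^ q) ≠
        (0 : Polynomial (MvPolynomial (Fin 2) F)) := by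
      intro e0
      refine (hasTrailing_specU0_d22s hF).ne_zero ?_
      rw [eD]
      linear_combination Polynomial.C (X 1) ^ q * e0
    refine ⟨a, by simp, ?_⟩
    have e1 : Polynomial.C (X 0 ^ q) * a = Polynomial.C (X 1 ^ q) *
        specU0 F ((-1) ^ (q - 1 - (s + 1)) * h (s + 1)) := by
      apply mul_left_cancel₀ hne
      rw [eu, eD] at e
      rw [map_pow, map_pow]
      linear_combination e
    rw [hg, pow_zero, one_mul] at e1
    have e2 := congrArg (fun f => Polynomial.coeff f 0) e1
    simp only [Polynomial.coeff_C_mul] at e2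
    rw [hg0] at e2
    apply mul_left_cancel₀ (pow_ne_zero q (X_ne_zero (0 : Fin 2)))
    obtain ⟨m, rfl⟩ : ∃ m, q = s + m + 2 := ⟨q - s - 2, by omega⟩
    rw [e2, show s + m + 2 - 1 - (s + 1) = m by omega, show s + m + 2 - 1 - s = m + 1 by omega]
    ring

omit hF [Fintype F] in
lemma hasTrailing_specX1_u0 : HasTrailing (specX1 F (u0 F)) 0 1 1 :=
  ⟨_, by rw [pow_zero, one_mul], by simp [specX1, u0]⟩

lemma hasTrailing_specX1_u1 : HasTrailing (specX1 F (u1 F q)) 0 q 1 := by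
  have hq : q ≠ 0 := hF ▸ Fintype.card_ne_zero
  exact ⟨_, by rw [pow_zero, one_mul], by
    simp [specX1, u1, hq, Polynomial.coeff_zero_eq_eval_zero]⟩

lemma hasTrailing_specX1_d22s : HasTrailing (specX1 F (-d22s F q)) 1 0 q := by
  have hq : 1 < q := hF ▸ Fintype.one_lt_card
  refine ⟨Polynomial.C (X 1) ^ q - Polynomial.C (X 1) * Polynomial.X ^ (q - 1), ?_, ?_⟩
  · have e : (Polynomial.X : Polynomial (MvPolynomial (Fin 2) F)) * Polynomial.X ^ (q - 1) =
      Polynomial.X ^ q := mul_pow_sub_one (by omega) _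
    simp [specX1, d22s]
    linear_combination Polynomial.C (X 1) * e
  · simp [Polynomial.coeff_zero_eq_eval_zero, show q - 1 ≠ 0 by omega]

lemma specX1_d22 : specX1 F (d22 F q) = 0 := by
  have hq : q ≠ 0 := hF ▸ Fintype.card_ne_zero
  simp [specX1, d22, hq]

/-- If `d22 * f` lies in the algebra generated by the basic invariants, so does `f`. -/
lemma mem_genAlg_of_d22_mul_mem {c21 : R2 F}
    (hc21 : d22 F q * c21 = X 1 * X 0 ^ (q ^ 2) - X 0 * X 1 ^ (q ^ 2)) {h : ℕ → R2 F}
    (hh : ∀ s ≤ q - 1, u0 F ^ q * h s =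
      u1 F q ^ (s + 1) * d22s F q ^ (q - s - 1) + u1s F q ^ (q - s) * d22 F q ^ s) {f : R2 F}
    (hf : d22 F q * f ∈ genAlg F (u0 F) (-d22s F q) (u1 F q) (-u1s F q) (d22 F q)
      (fun s => (-1) ^ (q - 1 - s) * h s) (q - 1)) :
    f ∈ genAlg F (u0 F) (-d22s F q) (u1 F q) (-u1s F q) (d22 F q)
      (fun s => (-1) ^ (q - 1 - s) * h s) (q - 1) := by
  have hq : 1 < q := hF ▸ Fintype.one_lt_card
  have e1 : q - 1 + 1 = q := by omega
  have e2 : q - 1 + 2 = q + 1 := by omega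
  obtain ⟨y, hy, e⟩ := (invRel hF hh).exists_eq_d_mul (by omega) (specU0 F) (specX1 F) specU0_u0
    (by rw [e2]; exact hasTrailing_specU0_d22s hF) (by rw [e1]; exact hasTrailing_specU0_u1 hF)
    (by rw [e1]; exact hasTrailing_specU0_u1s hF) (by rw [e2]; exact hasTrailing_specU0_d22 hF)
    (fun s hs => e1.symm ▸ hasTrailing_specU0_h hF hc21 hh s hs) (specX1_d22 hF)
    hasTrailing_specX1_u0 (by rw [e1]; exact hasTrailing_specX1_u1 hF) (by rw [e1]; exact hasTrailing_specX1_d22s hF) hf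
    (by rw [map_mul, specX1_d22 hF, zero_mul])
  rwa [mul_left_cancel₀ (d22_ne_zero hF) e]

end Generators

section Invariance

variable {F : Type} [Field F]

lemma act_X0 {A : GL (Fin 2) F} (hA : A ∈ SL2 F) :
    act A (X 0) = C (A.val 1 1) * X 0 - C (A.val 1 0) * X 1 := by
  have hd : A.val.det = 1 := hA
  simp [act, hd]

lemma act_X1 {A : GL (Fin 2) F} (hA : A ∈ SL2 F) :
    act A (X 1) = C (A.val 0 0) * X 1 - C (A.val 0 1) * X 0 := by
  have hd : A.val.det = 1 := hA
  simp [act, hd]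

lemma act_X2 (A : GL (Fin 2) F) :
    act A (X 2) = C (A.val 0 0) * X 2 + C (A.val 0 1) * X 3 := by
  simp [act]

lemma act_X3 (A : GL (Fin 2) F) :
    act A (X 3) = C (A.val 1 0) * X 2 + C (A.val 1 1) * X 3 := by
  simp [act]

lemma C_det_eq_one {A : GL (Fin 2) F} (hA : A ∈ SL2 F) :
    (C (A.val 0 0) * C (A.val 1 1) - C (A.val 0 1) * C (A.val 1 0) : R2 F) = 1 := by
  have hd : A.val.det = 1 := hA
  rw [Matrix.det_fin_two] at hd
  rw [← C_mul, ← C_mul, ← C_sub, hd, C_1]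

lemma act_u0 {A : GL (Fin 2) F} (hA : A ∈ SL2 F) : act A (u0 F) = u0 F := by
  rw [u0, map_add, map_mul, map_mul, act_X0 hA, act_X1 hA, act_X2, act_X3]
  linear_combination (X 0 * X 2 + X 1 * X 3) * C_det_eq_one hA

variable [Fintype F] {q : ℕ} (hF : Fintype.card F = q)

include hF

lemma act_X0_pow {A : GL (Fin 2) F} (hA : A ∈ SL2 F) :
    act A (X 0) ^ q = C (A.val 1 1) * X 0 ^ q - C (A.val 1 0) * X 1 ^ q := by
  rw [act_X0 hA, sub_pow_card_field F hF, mul_pow, mul_pow, C_pow_card hF, C_pow_card hF]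

lemma act_X1_pow {A : GL (Fin 2) F} (hA : A ∈ SL2 F) :
    act A (X 1) ^ q = C (A.val 0 0) * X 1 ^ q - C (A.val 0 1) * X 0 ^ q := by
  rw [act_X1 hA, sub_pow_card_field F hF, mul_pow, mul_pow, C_pow_card hF, C_pow_card hF]

lemma act_X2_pow (A : GL (Fin 2) F) :
    act A (X 2) ^ q = C (A.val 0 0) * X 2 ^ q + C (A.val 0 1) * X 3 ^ q := by
  rw [act_X2, add_pow_card_field F hF, mul_pow, mul_pow, C_pow_card hF, C_pow_card hF]

lemma act_X3_pow (A : GL (Fin 2) F) :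
    act A (X 3) ^ q = C (A.val 1 0) * X 2 ^ q + C (A.val 1 1) * X 3 ^ q := by
  rw [act_X3, add_pow_card_field F hF, mul_pow, mul_pow, C_pow_card hF, C_pow_card hF]

lemma act_u1 {A : GL (Fin 2) F} (hA : A ∈ SL2 F) : act A (u1 F q) = u1 F q := by
  rw [u1, map_add, map_mul, map_mul, map_pow, map_pow, act_X0_pow hF hA, act_X1_pow hF hA, act_X2,
    act_X3]
  linear_combination (X 0 ^ q * X 2 + X 1 ^ q * X 3) * C_det_eq_one hA

lemma act_u1s {A : GL (Fin 2) F} (hA : A ∈ SL2 F) : act A (u1s F q) = u1s F q := by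
  rw [u1s, map_add, map_mul, map_mul, map_pow, map_pow, act_X0 hA, act_X1 hA, act_X2_pow hF,
    act_X3_pow hF]
  linear_combination (X 0 * X 2 ^ q + X 1 * X 3 ^ q) * C_det_eq_one hA

lemma act_d22 {A : GL (Fin 2) F} (hA : A ∈ SL2 F) : act A (d22 F q) = d22 F q := by
  rw [d22, map_sub, map_mul, map_mul, map_pow, map_pow, act_X0_pow hF hA, act_X1_pow hF hA,
    act_X0 hA, act_X1 hA]
  linear_combination (X 1 * X 0 ^ q - X 0 * X 1 ^ q) * C_det_eq_one hA

lemma act_d22s {A : GL (Fin 2) F} (hA : A ∈ SL2 F) : act A (d22s F q) = d22s F q := by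
  rw [d22s, map_sub, map_mul, map_mul, map_pow, map_pow, act_X2_pow hF, act_X3_pow hF,
    act_X2, act_X3]
  linear_combination (X 2 * X 3 ^ q - X 3 * X 2 ^ q) * C_det_eq_one hA

lemma act_h {h : ℕ → R2 F} (hh : ∀ s ≤ q - 1, u0 F ^ q * h s =
      u1 F q ^ (s + 1) * d22s F q ^ (q - s - 1) + u1s F q ^ (q - s) * d22 F q ^ s)
    {A : GL (Fin 2) F} (hA : A ∈ SL2 F) {s : ℕ} (hs : s ≤ q - 1) : act A (h s) = h s := by
  apply mul_left_cancel₀ (pow_ne_zero q (u0_ne_zero (F := F)))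
  have e := congrArg (act A) (hh s hs)
  simp only [map_add, map_mul, map_pow, act_u0 hA, act_u1 hF hA, act_u1s hF hA, act_d22 hF hA,
    act_d22s hF hA] at e
  rw [e, hh s hs]

lemma genAlg_le_invariantRing {h : ℕ → R2 F} (hh : ∀ s ≤ q - 1, u0 F ^ q * h s =
      u1 F q ^ (s + 1) * d22s F q ^ (q - s - 1) + u1s F q ^ (q - s) * d22 F q ^ s) :
    genAlg F (u0 F) (-d22s F q) (u1 F q) (-u1s F q) (d22 F q)
      (fun s => (-1) ^ (q - 1 - s) * h s) (q - 1) ≤ invariantRing (SL2 F) := by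
  refine Algebra.adjoin_le ?_
  rintro f ((rfl | rfl | rfl | rfl | rfl) | ⟨s, hs, rfl⟩) A hA
  · exact act_u0 hA
  · rw [map_neg, act_d22s hF hA]
  · exact act_u1 hF hA
  · rw [map_neg, act_u1s hF hA]
  · exact act_d22 hF hA
  · simp only [map_mul, map_pow, map_neg, map_one]
    rw [act_h hF hh hA hs]

lemma genAlg_eq_adjoin {c21 c21s : R2 F}
    (hc21 : d22 F q * c21 = X 1 * X 0 ^ (q ^ 2) - X 0 * X 1 ^ (q ^ 2))
    (hc21s : d22s F q * c21s = X 2 * X 3 ^ (q ^ 2) - X 3 * X 2 ^ (q ^ 2)) {h : ℕ → R2 F}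
    (hh : ∀ s ≤ q - 1, u0 F ^ q * h s =
      u1 F q ^ (s + 1) * d22s F q ^ (q - s - 1) + u1s F q ^ (q - s) * d22 F q ^ s) :
    genAlg F (u0 F) (-d22s F q) (u1 F q) (-u1s F q) (d22 F q)
      (fun s => (-1) ^ (q - 1 - s) * h s) (q - 1) =
      Algebra.adjoin F
        ({d22 F q, c21, d22s F q, c21s, u1s F q, u0 F, u1 F q} ∪
          {f | ∃ s, 1 ≤ s ∧ s ≤ q - 2 ∧ f = h s}) := by
  have hl := h_last_eq hF hc21 hh
  have h0 := h_zero_eq hF hc21s hh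
  have hsign : ∀ (S : Subalgebra F (R2 F)) (n : ℕ), (-1) ^ n ∈ S := fun S n =>
    pow_mem (neg_mem (one_mem _)) _
  apply le_antisymm
  · refine Algebra.adjoin_le ?_
    rintro f ((rfl | rfl | rfl | rfl | rfl) | ⟨s, hs, rfl⟩)
    · exact Algebra.subset_adjoin (by simp)
    · exact neg_mem (Algebra.subset_adjoin (by simp))
    · exact Algebra.subset_adjoin (by simp)
    · exact neg_mem (Algebra.subset_adjoin (by simp))
    · exact Algebra.subset_adjoin (by simp)
    · refine mul_mem (hsign _ _) ?_
      replace hs : s ≤ q - 1 := hs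
      rcases Nat.eq_zero_or_pos s with rfl | h1
      · rw [h0]
        exact Algebra.subset_adjoin (by simp)
      rcases eq_or_lt_of_le hs with rfl | h2
      · rw [hl]
        exact Algebra.subset_adjoin (by simp)
      · exact Algebra.subset_adjoin (Or.inr ⟨s, h1, by omega, rfl⟩)
  · have hmem : ∀ s ≤ q - 1, h s ∈ genAlg F (u0 F) (-d22s F q) (u1 F q) (-u1s F q) (d22 F q)
        (fun s => (-1) ^ (q - 1 - s) * h s) (q - 1) := by
      intro s hs
      have e : h s = (-1) ^ (q - 1 - s) * ((-1) ^ (q - 1 - s) * h s) := by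
        rw [← mul_assoc, ← mul_pow]
        simp
      rw [e]
      exact mul_mem (hsign _ _) (h_mem_genAlg F _ _ _ _ _
        (fun s => (-1) ^ (q - 1 - s) * h s) _ hs)
    refine Algebra.adjoin_le ?_
    rintro f ((rfl | rfl | rfl | rfl | rfl | rfl | rfl) | ⟨s, h1, h2, rfl⟩)
    · exact d_mem_genAlg F _ _ _ _ _ _ _
    · exact hl ▸ hmem _ le_rfl
    · exact neg_mem_iff.1 (D_mem_genAlg F _ _ _ _ _ _ _)
    · exact h0 ▸ hmem _ (Nat.zero_le _)
    · exact neg_mem_iff.1 (v_mem_genAlg F _ _ _ _ _ _ _)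
    · exact u0_mem_genAlg F _ _ _ _ _ _ _
    · exact u_mem_genAlg F _ _ _ _ _ _ _
    · exact hmem _ (by omega)

end Invariance

section Scale

variable {F : Type} [Field F]

/-- Scaling of the variables. -/
def scale (w : Fin 4 → F) : R2 F →ₐ[F] R2 F := aeval fun i => C (w i) * X i

lemma scale_X (w : Fin 4 → F) (i : Fin 4) : scale w (X i) = C (w i) * X i := by
  simp [scale]

lemma coeff_scale (w : Fin 4 → F) (P : R2 F) (m : Fin 4 →₀ ℕ) :
    (scale w P).coeff m = (∏ i, w i ^ m i) * P.coeff m := by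
  induction P using MvPolynomial.induction_on' with
  | monomial u a =>
    have e : scale w (monomial u a) = C (∏ i, w i ^ u i) * monomial u a := by
      rw [scale, aeval_monomial, monomial_eq, Finsupp.prod_fintype _ _ (by simp),
        Finsupp.prod_fintype _ _ (by simp)]
      simp only [mul_pow, Finset.prod_mul_distrib, map_prod, C_pow]
      rw [algebraMap_eq]
      ring
    rw [e, coeff_C_mul, coeff_monomial]
    split_ifs with h
    · rw [h]
    · simp
  | add p q hp hq => rw [map_add, coeff_add, coeff_add, hp, hq, mul_add]

lemma totalDegree_scale_le (w : Fin 4 → F) (P : R2 F) :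
    (scale w P).totalDegree ≤ P.totalDegree := by
  refine Finset.sup_mono fun m hm => ?_
  rw [mem_support_iff, coeff_scale] at hm
  exact mem_support_iff.2 (right_ne_zero_of_mul hm)

lemma X_dvd_sub_scale (w : Fin 4 → F) (i : Fin 4) (hw : ∀ j ≠ i, w j = 1) (hi : w i = 0)
    (P : R2 F) : X i ∣ P - scale w P := by
  rw [← Ideal.mem_span_singleton, ← Ideal.Quotient.mk_eq_mk_iff_sub_mem]
  have e : Ideal.Quotient.mkₐ F (Ideal.span {(X i : R2 F)}) =
      (Ideal.Quotient.mkₐ F (Ideal.span {(X i : R2 F)})).comp (scale w) := by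
    refine algHom_ext fun j => ?_
    rw [AlgHom.comp_apply, scale_X]
    by_cases hj : j = i
    · rw [hj, hi, C_0, zero_mul, map_zero]
      exact Ideal.Quotient.eq_zero_iff_mem.2 (Ideal.mem_span_singleton_self _)
    · rw [hw j hj, C_1, one_mul]
  exact DFunLike.congr_fun e P

end Scale

section LinearForms

variable {F : Type} [Field F]

/-- Restriction to the hyperplane `X 0 = a • X 1`. -/
def restrictLine (a : F) : R2 F →ₐ[F] MvPolynomial (Fin 3) F :=
  aeval (![C a * X 0, X 0, X 1, X 2] : Fin 4 → MvPolynomial (Fin 3) F)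

/-- The product of the linear forms `X 0 - a • X 1`. -/
def lineProd (F : Type) [Field F] (q : ℕ) : R2 F := X 0 ^ q - X 0 * X 1 ^ (q - 1)

/-- The substitution of linear combinations of `X 0, X 1` induced by a matrix with entries
`a, b, c, d` of determinant one. -/
def act01 (a b c d : F) : R2 F →ₐ[F] R2 F :=
  aeval ![C d * X 0 - C c * X 1, C a * X 1 - C b * X 0, X 2, X 3]

lemma act01_X0 (a b c d : F) : act01 a b c d (X 0) = C d * X 0 - C c * X 1 := by simp [act01]

lemma act01_X1 (a b c d : F) : act01 a b c d (X 1) = C a * X 1 - C b * X 0 := by simp [act01]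

lemma act01_X2 (a b c d : F) : act01 a b c d (X 2) = X 2 := by simp [act01]

lemma act01_X3 (a b c d : F) : act01 a b c d (X 3) = X 3 := by simp [act01]

lemma algHom_ext_four {A : Type*} [Semiring A] [Algebra F A] {f g : R2 F →ₐ[F] A}
    (h0 : f (X 0) = g (X 0)) (h1 : f (X 1) = g (X 1)) (h2 : f (X 2) = g (X 2))
    (h3 : f (X 3) = g (X 3)) : f = g := by
  refine algHom_ext fun i => ?_
  fin_cases i <;> assumption

lemma restrictLine_zero_act01 (a : F) (G : R2 F) :
    restrictLine 0 (act01 1 0 (-a) 1 G) = restrictLine a G := by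
  rw [← AlgHom.comp_apply]
  congr 1
  apply algHom_ext_four <;> simp [restrictLine, act01]

variable [Fintype F] {q : ℕ} (hF : Fintype.card F = q)

include hF

lemma lineProd_dvd {G : R2 F} (hG : ∀ a, restrictLine a G = 0) : lineProd F q ∣ G := by
  have hq : 1 < q := hF ▸ Fintype.one_lt_card
  let Q : Polynomial (MvPolynomial (Fin 3) F) :=
    Polynomial.X ^ q - Polynomial.C (X 0 ^ (q - 1)) * Polynomial.X
  have hlt : (Polynomial.C (X 0 ^ (q - 1)) * Polynomial.X :
      Polynomial (MvPolynomial (Fin 3) F)).degree < q :=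
    (Polynomial.degree_C_mul_X_le _).trans_lt (by exact_mod_cast hq)
  have hQ : Q.Monic := Polynomial.monic_X_pow_sub hlt
  have hQd : Q.natDegree = q := by
    apply Polynomial.natDegree_eq_of_degree_eq_some
    simp only [Q]
    rw [Polynomial.degree_sub_eq_left_of_degree_lt, Polynomial.degree_X_pow]
    rwa [Polynomial.degree_X_pow]
  have hQN : finSuccEquiv F 3 (lineProd F q) = Q := by
    have h1 : finSuccEquiv F 3 (X 1) = Polynomial.C (X 0) := finSuccEquiv_X_succ (j := 0)
    simp only [lineProd, map_sub, map_mul, map_pow, finSuccEquiv_X_zero, h1, Q]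
    ring
  have hev : ∀ (a : F) (P : R2 F), (finSuccEquiv F 3 P).eval (C a * X 0) = restrictLine a P := by
    intro a P
    have : ((Polynomial.aeval (C a * X 0 : MvPolynomial (Fin 3) F)).restrictScalars F).comp
        (finSuccEquiv F 3).toAlgHom = restrictLine a := by
      have h1 : finSuccEquiv F 3 (X 1) = Polynomial.C (X 0) := finSuccEquiv_X_succ (j := 0)
      have h2 : finSuccEquiv F 3 (X 2) = Polynomial.C (X 1) := finSuccEquiv_X_succ (j := 1)
      have h3 : finSuccEquiv F 3 (X 3) = Polynomial.C (X 2) := finSuccEquiv_X_succ (j := 2)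
      apply algHom_ext_four <;>
        simp [restrictLine, h1, h2, h3, finSuccEquiv_X_zero]
    rw [← this]
    simp
  have hQev : ∀ a : F, Q.eval (C a * X 0) = 0 := by
    intro a
    simp only [Q, Polynomial.eval_sub, Polynomial.eval_pow, Polynomial.eval_mul,
      Polynomial.eval_C, Polynomial.eval_X, mul_pow, C_pow_card hF]
    rw [← mul_pow_sub_one (by omega : q ≠ 0) (X 0 : MvPolynomial (Fin 3) F)]
    ring
  have hmod : finSuccEquiv F 3 G %ₘ Q = 0 := by
    refine Polynomial.eq_zero_of_natDegree_lt_card_of_eval_eq_zero _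
      (f := fun a : F => (C a * X 0 : MvPolynomial (Fin 3) F)) ?_ ?_ ?_
    · intro a b hab
      exact C_injective _ _ (mul_right_cancel₀ (X_ne_zero _) hab)
    · intro a
      have := congrArg (Polynomial.eval (C a * X 0)) (Polynomial.modByMonic_add_div
        (finSuccEquiv F 3 G) Q)
      simpa [hQev, hev, hG] using this
    · rw [hF]
      calc _ < Q.natDegree := Polynomial.natDegree_modByMonic_lt _ hQ (by
            intro e
            rw [e, Polynomial.natDegree_one] at hQd
            omega)
        _ = q := hQd
  rw [Polynomial.modByMonic_eq_zero_iff_dvd hQ, ← hQN] at hmod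
  exact (map_dvd_iff (finSuccEquiv F 3)).1 hmod

omit [Fintype F] hF in
lemma X1_mul_lineProd (hq : q ≠ 0) : X 1 * lineProd F q = d22 F q := by
  rw [lineProd, d22, ← mul_pow_sub_one hq (X 1)]
  ring

lemma act01_d22 {a b c d : F} (hdet : a * d - b * c = 1) :
    act01 a b c d (d22 F q) = d22 F q := by
  have hd : (C a * C d - C b * C c : R2 F) = 1 := by
    rw [← C_mul, ← C_mul, ← C_sub, hdet, C_1]
  rw [d22, map_sub, map_mul, map_mul, map_pow, map_pow, act01_X0, act01_X1,
    sub_pow_card_field F hF, sub_pow_card_field F hF]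
  simp only [mul_pow, C_pow_card hF]
  linear_combination (X 1 * X 0 ^ q - X 0 * X 1 ^ q) * hd

lemma act01_c21 {c21 : R2 F} (hc21 : d22 F q * c21 = X 1 * X 0 ^ (q ^ 2) - X 0 * X 1 ^ (q ^ 2))
    {a b c d : F} (hdet : a * d - b * c = 1) : act01 a b c d c21 = c21 := by
  have hd : (C a * C d - C b * C c : R2 F) = 1 := by
    rw [← C_mul, ← C_mul, ← C_sub, hdet, C_1]
  apply mul_left_cancel₀ (d22_ne_zero hF)
  rw [hc21]
  nth_rewrite 1 [← act01_d22 hF hdet]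
  rw [← map_mul, hc21, map_sub, map_mul, map_mul, map_pow, map_pow, act01_X0, act01_X1, pow_two,
    pow_mul, pow_mul]
  simp only [mul_pow, C_pow_card hF, sub_pow_card_field F hF]
  linear_combination (X 1 * (X 0 ^ q) ^ q - X 0 * (X 1 ^ q) ^ q) * hd

lemma act01_lineProd (a : F) : act01 1 0 (-a) 1 (lineProd F q) = lineProd F q := by
  have hq : q ≠ 0 := hF ▸ Fintype.card_ne_zero
  have e := act01_d22 hF (show (1 : F) * 1 - 0 * (-a) = 1 by ring)
  rw [← X1_mul_lineProd hq, map_mul, act01_X1, C_1, C_0, one_mul, zero_mul, sub_zero] at e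
  exact mul_left_cancel₀ (X_ne_zero _) e

lemma lineProd_ne_zero : lineProd F q ≠ 0 := by
  intro e
  have := d22_ne_zero hF
  rw [← X1_mul_lineProd (hF ▸ Fintype.card_ne_zero), e, mul_zero] at this
  exact this rfl

end LinearForms

section Dickson

variable {F : Type} [Field F]

/-- Setting `X 0 = 0`. -/
abbrev killX0 (F : Type) [Field F] : R2 F →ₐ[F] R2 F := scale ![0, 1, 1, 1]

/-- Setting `X 1 = 0`. -/
abbrev killX1 (F : Type) [Field F] : R2 F →ₐ[F] R2 F := scale ![1, 0, 1, 1]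

lemma coeff_killX1 (P : R2 F) (m : Fin 4 →₀ ℕ) :
    (killX1 F P).coeff m = if m 1 = 0 then P.coeff m else 0 := by
  rw [coeff_scale, Fin.prod_univ_four]
  split_ifs with h <;> simp [h]

lemma coeff_killX0 (P : R2 F) (m : Fin 4 →₀ ℕ) :
    (killX0 F P).coeff m = if m 0 = 0 then P.coeff m else 0 := by
  rw [coeff_scale, Fin.prod_univ_four]
  split_ifs with h <;> simp [h]

lemma X1_dvd_of_killX1 {P : R2 F} (h : killX1 F P = 0) : X 1 ∣ P := by
  have := X_dvd_sub_scale ![1, 0, 1, 1] 1 (by intro j hj; fin_cases j <;> simp at hj ⊢) rfl P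
  rwa [h, sub_zero] at this

lemma killX1_lineProd {q : ℕ} (hq : 1 < q) : killX1 F (lineProd F q) = X 0 ^ q := by
  simp [lineProd, scale_X, show q - 1 ≠ 0 by omega]

variable [Fintype F] {q : ℕ} (hF : Fintype.card F = q)

include hF

lemma card_dvd_of_translation_invariant (n : ℕ) : ∀ (G : R2 F),
    (∀ a, act01 1 0 (-a) 1 G = G) → ∀ m : Fin 4 →₀ ℕ, m 0 = n → m 1 = 0 → G.coeff m ≠ 0 →
      q ∣ n := by
  have hq : 1 < q := hF ▸ Fintype.one_lt_card
  induction n using Nat.strong_induction_on with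
  | _ n ih =>
  intro G hG m hm0 hm1 hm
  rcases Nat.eq_zero_or_pos n with rfl | hn
  · exact dvd_zero q
  have hι : ∀ a, act01 1 0 (-a) 1 (killX0 F G) = killX0 F G := by
    intro a
    rw [← AlgHom.comp_apply]
    congr 1
    apply algHom_ext_four <;> simp [scale, act01]
  have hdvd : lineProd F q ∣ G - killX0 F G := by
    refine lineProd_dvd hF fun a => ?_
    rw [← restrictLine_zero_act01, map_sub, hG, hι, map_sub, sub_eq_zero, ← AlgHom.comp_apply]
    congr 1
    apply algHom_ext_four <;> simp [scale, restrictLine]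
  obtain ⟨G', hG'⟩ := hdvd
  have hinv : ∀ a, act01 1 0 (-a) 1 G' = G' := by
    intro a
    apply mul_left_cancel₀ (lineProd_ne_zero hF)
    nth_rewrite 1 [← act01_lineProd hF a]
    rw [← map_mul, ← hG', map_sub, hG, hι]
  have hc : (killX1 F G).coeff m = (X 0 ^ q * killX1 F G').coeff m := by
    rw [← killX1_lineProd hq, ← map_mul, ← hG', map_sub, coeff_sub, coeff_killX1 (killX0 F G),
      coeff_killX0, if_neg (by omega : ¬ m 0 = 0), ite_self, sub_zero]
  rw [coeff_killX1, if_pos hm1, X_pow_eq_monomial, coeff_monomial_mul', one_mul] at hc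
  rw [hc] at hm
  split_ifs at hm with hle
  · rw [coeff_killX1] at hm
    have hle0 : q ≤ m 0 := by simpa using hle 0
    split_ifs at hm with h1
    · have := ih (n - q) (by omega) G' hinv (m - Finsupp.single 0 q) (by simp [hm0]) h1 hm
      have h2 := dvd_add this (dvd_refl q)
      rwa [Nat.sub_add_cancel (by omega)] at h2
    · exact absurd rfl hm
  · exact absurd rfl hm

lemma card_mul_dvd_of_invariant {G : R2 F}
    (hG : ∀ a b c d : F, a * d - b * c = 1 → act01 a b c d G = G) {m : Fin 4 →₀ ℕ}
    (hm1 : m 1 = 0) (hm : G.coeff m ≠ 0) : q * (q - 1) ∣ m 0 := by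
  have hq : 1 < q := hF ▸ Fintype.one_lt_card
  have h1 : q ∣ m 0 := card_dvd_of_translation_invariant hF (m 0) G
    (fun a => hG _ _ _ _ (by ring)) m rfl hm1 hm
  have h2 : q - 1 ∣ m 0 := by
    rw [← hF, ← FiniteField.forall_pow_eq_one_iff F]
    intro t
    have e := hG (↑t⁻¹ : F) 0 0 t (by simp)
    have e1 : act01 (↑t⁻¹ : F) 0 0 t = scale ![(t : F), ↑t⁻¹, 1, 1] := by
      apply algHom_ext_four <;> simp [act01, scale]
    rw [e1] at e
    have e2 := congrArg (coeff m) e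
    rw [coeff_scale, Fin.prod_univ_four] at e2
    simp only [Matrix.cons_val, hm1, pow_zero, one_pow, mul_one] at e2
    exact Units.ext (by simpa using mul_right_cancel₀ hm (e2.trans (one_mul _).symm))
  refine Nat.Coprime.mul_dvd_of_dvd_of_dvd ?_ h1 h2
  obtain ⟨r, rfl⟩ := Nat.exists_eq_add_of_le' hq.le
  simp

lemma totalDegree_d22 : (d22 F q).totalDegree = q + 1 := by
  refine IsHomogeneous.totalDegree ?_ (d22_ne_zero hF)
  have h0 := isHomogeneous_X F (0 : Fin 4)
  have h1 := isHomogeneous_X F (1 : Fin 4)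
  refine IsHomogeneous.sub ?_ ?_
  · simpa [add_comm] using h1.mul (h0.pow q)
  · simpa [add_comm] using h0.mul (h1.pow q)

lemma killX1_c21 {c21 : R2 F}
    (hc21 : d22 F q * c21 = X 1 * X 0 ^ (q ^ 2) - X 0 * X 1 ^ (q ^ 2)) :
    killX1 F c21 = X 0 ^ (q * (q - 1)) := by
  have hq : 1 < q := hF ▸ Fintype.one_lt_card
  have hq2 : 1 < q ^ 2 := Nat.one_lt_pow two_ne_zero hq
  have e : lineProd F q * c21 = X 0 ^ (q ^ 2) - X 0 * X 1 ^ (q ^ 2 - 1) := by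
    apply mul_left_cancel₀ (X_ne_zero (1 : Fin 4))
    rw [← mul_assoc, X1_mul_lineProd (by omega), hc21, ← mul_pow_sub_one (by omega : q ^ 2 ≠ 0)
      (X 1)]
    ring
  have e2 := congrArg (killX1 F) e
  rw [map_mul, killX1_lineProd hq] at e2
  apply mul_left_cancel₀ (pow_ne_zero q (X_ne_zero (0 : Fin 4)))
  rw [e2, ← pow_add]
  obtain ⟨r, rfl⟩ := Nat.exists_eq_add_of_le' hq.le
  simp only [map_sub, map_mul, map_pow, scale_X]
  simp [show (r + 1) ^ 2 - 1 ≠ 0 by omega]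
  ring

lemma c21_ne_zero {c21 : R2 F}
    (hc21 : d22 F q * c21 = X 1 * X 0 ^ (q ^ 2) - X 0 * X 1 ^ (q ^ 2)) : c21 ≠ 0 := by
  rintro rfl
  have := killX1_c21 hF hc21
  rw [map_zero] at this
  exact pow_ne_zero _ (X_ne_zero (0 : Fin 4)) this.symm

lemma totalDegree_c21_le {c21 : R2 F}
    (hc21 : d22 F q * c21 = X 1 * X 0 ^ (q ^ 2) - X 0 * X 1 ^ (q ^ 2)) :
    c21.totalDegree ≤ q * (q - 1) := by
  have hq : 1 < q := hF ▸ Fintype.one_lt_card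
  have h0 := isHomogeneous_X F (0 : Fin 4)
  have h1 := isHomogeneous_X F (1 : Fin 4)
  have hh : (X 1 * X 0 ^ (q ^ 2) - X 0 * X 1 ^ (q ^ 2) : R2 F).IsHomogeneous (q ^ 2 + 1) := by
    refine IsHomogeneous.sub ?_ ?_
    · rw [add_comm, ← one_mul (q ^ 2)]
      simpa only [one_mul] using h1.mul (h0.pow (q ^ 2))
    · rw [add_comm, ← one_mul (q ^ 2)]
      simpa only [one_mul] using h0.mul (h1.pow (q ^ 2))
  have h2 := hh.totalDegree_le
  rw [← hc21, totalDegree_mul_of_isDomain (d22_ne_zero hF) (c21_ne_zero hF hc21),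
    totalDegree_d22 hF] at h2
  obtain ⟨r, rfl⟩ := Nat.exists_eq_add_of_le' hq.le
  rw [Nat.add_sub_cancel]
  nlinarith

/-- Dickson's theorem for `SL₂`, with the variables `X 2, X 3` as parameters. -/
lemma mem_adjoin_of_invariant {c21 : R2 F}
    (hc21 : d22 F q * c21 = X 1 * X 0 ^ (q ^ 2) - X 0 * X 1 ^ (q ^ 2)) (n : ℕ) : ∀ G : R2 F,
    (∀ a b c d : F, a * d - b * c = 1 → act01 a b c d G = G) → G.totalDegree ≤ n →
      G ∈ Algebra.adjoin F {d22 F q, c21, X 2, X 3} := by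
  have hq : 1 < q := hF ▸ Fintype.one_lt_card
  have md : d22 F q ∈ Algebra.adjoin F {d22 F q, c21, X 2, X 3} :=
    Algebra.subset_adjoin (by simp)
  have mc : c21 ∈ Algebra.adjoin F {d22 F q, c21, X 2, X 3} := Algebra.subset_adjoin (by simp)
  have m2 : X 2 ∈ Algebra.adjoin F {d22 F q, c21, X 2, X 3} := Algebra.subset_adjoin (by simp)
  have m3 : X 3 ∈ Algebra.adjoin F {d22 F q, c21, X 2, X 3} := Algebra.subset_adjoin (by simp)
  induction n using Nat.strong_induction_on with
  | _ n ih =>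
  intro G hG hn
  let T : (Fin 4 →₀ ℕ) → R2 F := fun m =>
    C (G.coeff m) * (c21 ^ (m 0 / (q * (q - 1))) * X 2 ^ m 2 * X 3 ^ m 3)
  let G1 : R2 F := ∑ m ∈ (killX1 F G).support, T m
  have hsupp : ∀ m ∈ (killX1 F G).support, m 1 = 0 ∧ G.coeff m ≠ 0 := by
    intro m hm
    rw [mem_support_iff, coeff_killX1] at hm
    split_ifs at hm with h
    · exact ⟨h, hm⟩
    · exact absurd rfl hm
  have hG1mem : G1 ∈ Algebra.adjoin F {d22 F q, c21, X 2, X 3} :=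
    sum_mem fun m _ => mul_mem (Subalgebra.algebraMap_mem _ _)
      (mul_mem (mul_mem (pow_mem mc _) (pow_mem m2 _)) (pow_mem m3 _))
  have hG1inv : ∀ a b c d : F, a * d - b * c = 1 → act01 a b c d G1 = G1 := by
    intro a b c d hdet
    simp only [G1, T, map_sum, map_mul, map_pow, act01_X2, act01_X3, act01_c21 hF hc21 hdet,
      algHom_C, algebraMap_eq]
  have hG1kill : killX1 F G1 = killX1 F G := by
    rw [(killX1 F G).as_sum, map_sum]
    refine Finset.sum_congr rfl fun m hm => ?_
    obtain ⟨hm1, hm⟩ := hsupp m hm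
    simp only [T, map_mul, map_pow, killX1_c21 hF hc21, scale_X, algHom_C, algebraMap_eq]
    rw [coeff_killX1, if_pos hm1, monomial_eq, Finsupp.prod_fintype _ _ (by simp),
      Fin.prod_univ_four, hm1, ← pow_mul, Nat.mul_div_cancel' (card_mul_dvd_of_invariant hF hG hm1 hm)]
    simp
  have hG1deg : G1.totalDegree ≤ n := by
    refine (totalDegree_finsetSum _ _).trans (Finset.sup_le fun m hm => ?_)
    have hmd : m 0 + m 1 + m 2 + m 3 ≤ n := by
      have := (le_totalDegree hm).trans ((totalDegree_scale_le _ G).trans hn)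
      rwa [Finsupp.sum_fintype _ _ (by simp), Fin.sum_univ_four] at this
    obtain ⟨hm1, hm⟩ := hsupp m hm
    calc (T m).totalDegree ≤ 0 + (m 0 / (q * (q - 1)) * (q * (q - 1)) + m 2 + m 3) := by
          refine (totalDegree_mul _ _).trans (add_le_add (totalDegree_C _).le ?_)
          refine (totalDegree_mul _ _).trans (add_le_add ((totalDegree_mul _ _).trans
            (add_le_add ?_ (totalDegree_X_pow _ _).le)) (totalDegree_X_pow _ _).le)
          exact (totalDegree_pow _ _).trans (Nat.mul_le_mul_left _ (totalDegree_c21_le hF hc21))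
      _ ≤ n := by
        have := Nat.div_mul_le_self (m 0) (q * (q - 1))
        omega
  have hk : killX1 F (G - G1) = 0 := by rw [map_sub, hG1kill, sub_self]
  have hinv : ∀ a b c d : F, a * d - b * c = 1 → act01 a b c d (G - G1) = G - G1 := by
    intro a b c d hdet
    rw [map_sub, hG _ _ _ _ hdet, hG1inv _ _ _ _ hdet]
  have hline : ∀ a, restrictLine a (G - G1) = 0 := by
    intro a
    rw [← restrictLine_zero_act01, hinv _ _ _ _ (by ring), ← hinv 0 1 (-1) 0 (by ring)]
    have e : (restrictLine (0 : F)).comp (act01 0 1 (-1) 0) =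
        (aeval (![X 0, 0, X 1, X 2] : Fin 4 → MvPolynomial (Fin 3) F)).comp (killX1 F) := by
      apply algHom_ext_four <;> simp [restrictLine, act01, scale]
    rw [← AlgHom.comp_apply, e, AlgHom.comp_apply, hk, map_zero]
  obtain ⟨K, hK⟩ := lineProd_dvd hF hline
  obtain ⟨K', rfl⟩ : X 1 ∣ K := by
    apply X1_dvd_of_killX1
    rw [hK, map_mul, killX1_lineProd hq] at hk
    exact (mul_eq_zero.1 hk).resolve_left (pow_ne_zero _ (X_ne_zero _))
  have hKd : G - G1 = d22 F q * K' := by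
    rw [hK, ← X1_mul_lineProd (by omega)]
    ring
  have hK'mem : K' ∈ Algebra.adjoin F {d22 F q, c21, X 2, X 3} := by
    by_cases hK0 : K' = 0
    · rw [hK0]
      exact zero_mem _
    have hdeg : (G - G1).totalDegree ≤ n := (totalDegree_sub _ _).trans (max_le hn hG1deg)
    rw [hKd, totalDegree_mul_of_isDomain (d22_ne_zero hF) hK0, totalDegree_d22 hF] at hdeg
    refine ih (n - 1) (by omega) K' (fun a b c d hdet => ?_) (by omega)
    apply mul_left_cancel₀ (d22_ne_zero hF)
    nth_rewrite 1 [← act01_d22 hF hdet]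
    rw [← map_mul, ← hKd, hinv _ _ _ _ hdet]
  rw [← sub_add_cancel G G1, hKd]
  exact add_mem (mul_mem md hK'mem) hG1mem

end Dickson

section Reduction

variable {F : Type} [Field F] {q : ℕ}

/-- The substitution `X 2 ↦ u₀`, `X 3 ↦ u₁`, which becomes an isomorphism after inverting `d₂₂`. -/
def substU (F : Type) [Field F] (q : ℕ) : R2 F →ₐ[F] R2 F :=
  aeval ![X 0, X 1, u0 F, u1 F q]

lemma substU_X0 : substU F q (X 0) = X 0 := by simp [substU]

lemma substU_X1 : substU F q (X 1) = X 1 := by simp [substU]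

lemma substU_X2 : substU F q (X 2) = u0 F := by simp [substU]

lemma substU_X3 : substU F q (X 3) = u1 F q := by simp [substU]

lemma substU_d22 : substU F q (d22 F q) = d22 F q := by
  simp only [d22, map_sub, map_mul, map_pow, substU_X0, substU_X1]

lemma d22_mul_X2 : d22 F q * X 2 = substU F q (X 1 * X 3 - X 1 ^ q * X 2) := by
  simp only [map_sub, map_mul, map_pow, substU_X1, substU_X2, substU_X3, d22, u0, u1]
  ring

lemma d22_mul_X3 : d22 F q * X 3 = substU F q (X 0 ^ q * X 2 - X 0 * X 3) := by
  simp only [map_sub, map_mul, map_pow, substU_X0, substU_X2, substU_X3, d22, u0, u1]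
  ring

lemma exists_d22_pow_mul_eq_substU (f : R2 F) :
    ∃ (n : ℕ) (G : R2 F), d22 F q ^ n * f = substU F q G := by
  induction f using MvPolynomial.induction_on with
  | C a => exact ⟨0, C a, by simp [substU]⟩
  | add f g hf hg =>
    obtain ⟨n, G, hG⟩ := hf
    obtain ⟨m, H, hH⟩ := hg
    refine ⟨n + m, d22 F q ^ m * G + d22 F q ^ n * H, ?_⟩
    rw [map_add, map_mul, map_mul, map_pow, map_pow, substU_d22, ← hG, ← hH]
    ring
  | mul_X f i hf =>
    obtain ⟨n, G, hG⟩ := hf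
    have key : ∃ Y : R2 F, d22 F q * X i = substU F q Y := by
      fin_cases i
      · exact ⟨d22 F q * X 0, by rw [map_mul, substU_d22, substU_X0]; rfl⟩
      · exact ⟨d22 F q * X 1, by rw [map_mul, substU_d22, substU_X1]; rfl⟩
      · exact ⟨_, d22_mul_X2⟩
      · exact ⟨_, d22_mul_X3⟩
    obtain ⟨Y, hY⟩ := key
    refine ⟨n + 1, G * Y, ?_⟩
    rw [map_mul, ← hG, ← hY]
    ring

lemma act_substU_of_mem [Fintype F] (hF : Fintype.card F = q) {A : GL (Fin 2) F}
    (hA : A ∈ SL2 F) (G : R2 F) :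
    act A (substU F q G) =
      substU F q (act01 (A.val 0 0) (A.val 0 1) (A.val 1 0) (A.val 1 1) G) := by
  rw [← AlgHom.comp_apply, ← AlgHom.comp_apply]
  congr 1
  apply algHom_ext_four <;>
    simp only [AlgHom.comp_apply, substU_X0, substU_X1, substU_X2, substU_X3, act01_X0, act01_X1,
      act01_X2, act01_X3, act_X0 hA, act_X1 hA, act_u0 hA, act_u1 hF hA, map_sub, map_mul,
      algHom_C, algebraMap_eq]

variable [Fintype F] (hF : Fintype.card F = q)

include hF

lemma substU_injective : Function.Injective (substU F q) := by
  let K := FractionRing (R2 F)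
  let ι := algebraMap (R2 F) K
  have hd : ι (d22 F q) ≠ 0 := by
    simpa [ι] using d22_ne_zero hF
  let φ : R2 F →ₐ[F] K := aeval ![ι (X 0), ι (X 1),
    ι (X 1 * X 3 - X 1 ^ q * X 2) / ι (d22 F q), ι (X 0 ^ q * X 2 - X 0 * X 3) / ι (d22 F q)]
  have e : φ.comp (substU F q) = IsScalarTower.toAlgHom F (R2 F) K := by
    apply algHom_ext_four
    · simp [φ, substU_X0, ι]
    · simp [φ, substU_X1, ι]
    · rw [AlgHom.comp_apply, substU_X2]
      simp only [u0, φ, map_add, map_mul, aeval_X, Matrix.cons_val, IsScalarTower.coe_toAlgHom']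
      rw [← mul_div_assoc, ← mul_div_assoc, ← add_div, div_eq_iff hd, ← map_mul, ← map_mul,
        ← map_add, ← map_mul]
      congr 1
      rw [d22]
      ring
    · rw [AlgHom.comp_apply, substU_X3]
      simp only [u1, φ, map_add, map_mul, map_pow, aeval_X, Matrix.cons_val,
        IsScalarTower.coe_toAlgHom']
      rw [← mul_div_assoc, ← mul_div_assoc, ← add_div, div_eq_iff hd, ← map_pow, ← map_pow,
        ← map_mul, ← map_mul, ← map_add, ← map_mul]
      congr 1
      rw [d22]
      ring
  have hinj : Function.Injective (φ.comp (substU F q)) := by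
    rw [e]
    exact IsFractionRing.injective (R2 F) K
  exact Function.Injective.of_comp (f := φ) hinj

lemma act01_eq_of_mem_invariantRing {G : R2 F} (hG : substU F q G ∈ invariantRing (SL2 F))
    {a b c d : F} (hdet : a * d - b * c = 1) : act01 a b c d G = G := by
  have hM : (!![a, b; c, d] : Matrix (Fin 2) (Fin 2) F).det = 1 := by
    rw [Matrix.det_fin_two_of, hdet]
  let A : GL (Fin 2) F := Matrix.GeneralLinearGroup.mkOfDetNeZero !![a, b; c, d] (by simp [hM])
  have hA : A ∈ SL2 F := hM
  apply substU_injective hF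
  exact (act_substU_of_mem hF hA G).symm.trans (hG A hA)

lemma mem_genAlg_of_mem_invariantRing {c21 : R2 F}
    (hc21 : d22 F q * c21 = X 1 * X 0 ^ (q ^ 2) - X 0 * X 1 ^ (q ^ 2))
    {h : ℕ → R2 F} (hh : ∀ s ≤ q - 1, u0 F ^ q * h s =
      u1 F q ^ (s + 1) * d22s F q ^ (q - s - 1) + u1s F q ^ (q - s) * d22 F q ^ s)
    {f : R2 F} (hf : f ∈ invariantRing (SL2 F)) :
    f ∈ genAlg F (u0 F) (-d22s F q) (u1 F q) (-u1s F q) (d22 F q)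
      (fun s => (-1) ^ (q - 1 - s) * h s) (q - 1) := by
  obtain ⟨n, G, hG⟩ := exists_d22_pow_mul_eq_substU (q := q) f
  have hGinv : substU F q G ∈ invariantRing (SL2 F) := by
    rw [← hG]
    have hd : d22 F q ∈ invariantRing (SL2 F) := fun A hA => act_d22 hF hA
    exact mul_mem (pow_mem hd n) hf
  have hGmem := mem_adjoin_of_invariant hF hc21 G.totalDegree G
    (fun a b c d hdet => act01_eq_of_mem_invariantRing hF hGinv hdet) le_rfl
  have hc : substU F q c21 = c21 := by
    apply mul_left_cancel₀ (d22_ne_zero hF)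
    nth_rewrite 1 [← substU_d22]
    rw [← map_mul, hc21]
    simp only [map_sub, map_mul, map_pow, substU_X0, substU_X1]
  have hmem : d22 F q ^ n * f ∈ genAlg F (u0 F) (-d22s F q) (u1 F q) (-u1s F q) (d22 F q)
      (fun s => (-1) ^ (q - 1 - s) * h s) (q - 1) := by
    rw [hG]
    have : substU F q G ∈ (Algebra.adjoin F {d22 F q, c21, X 2, X 3}).map (substU F q) :=
      ⟨G, hGmem, rfl⟩
    rw [AlgHom.map_adjoin] at this
    refine Algebra.adjoin_le ?_ this
    rintro _ ⟨x, hx, rfl⟩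
    rcases hx with rfl | rfl | rfl | rfl
    · rw [substU_d22]
      exact d_mem_genAlg F _ _ _ _ _ _ _
    · rw [hc, ← h_last_eq hF hc21 hh]
      simpa using h_mem_genAlg F (u0 F) (-d22s F q) (u1 F q) (-u1s F q) (d22 F q)
        (fun s => (-1) ^ (q - 1 - s) * h s) (q - 1) (le_refl (q - 1))
    · rw [substU_X2]
      exact u0_mem_genAlg F _ _ _ _ _ _ _
    · rw [substU_X3]
      exact u_mem_genAlg F _ _ _ _ _ _ _
  clear hG
  induction n with
  | zero => simpa using hmem
  | succ n ih =>
    apply ih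
    apply mem_genAlg_of_d22_mul_mem hF hc21 hh
    rwa [← mul_assoc, ← pow_succ']

end Reduction

/-- `R₂^{SL₂}` is generated as an `F_q`-algebra by
`{d₂₂, c₂₁, d₂₂*, c₂₁*, u₁*, u₀, u₁} ∪ {h_s : 1 ≤ s ≤ q−2}`. -/
theorem stmt_18 (q : ℕ) (hq : IsPrimePow q) (F : Type) [Field F] [Fintype F]
    (hF : Fintype.card F = q)
    (c21 c21s : R2 F)
    (hc21 : d22 F q * c21 = X 1 * X 0 ^ (q ^ 2) - X 0 * X 1 ^ (q ^ 2))
    (hc21s : d22s F q * c21s = X 2 * X 3 ^ (q ^ 2) - X 3 * X 2 ^ (q ^ 2))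
    (h : ℕ → R2 F)
    (hh : ∀ s ≤ q - 1, u0 F ^ q * h s =
      u1 F q ^ (s + 1) * d22s F q ^ (q - s - 1) + u1s F q ^ (q - s) * d22 F q ^ s) :
    invariantRing (SL2 F) =
      Algebra.adjoin F
        ({d22 F q, c21, d22s F q, c21s, u1s F q, u0 F, u1 F q} ∪
          {f | ∃ s, 1 ≤ s ∧ s ≤ q - 2 ∧ f = h s}) := by
  rw [← genAlg_eq_adjoin hF hc21 hc21s hh]
  exact le_antisymm (fun f hf => mem_genAlg_of_mem_invariantRing hF hc21 hh hf)
    (genAlg_le_invariantRing hF hh)
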